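/- arXiv:2103.13735 — 2 statements merged into one kernel-verified Lean document; each statement's English description precedes it below -/
import Mathlib

section
/- Let f = (f_1,…,f_s) ⊂ ℚ[y][x] with x = (x_1,…,x_n), y = (y_1,…,y_t), satisfy Assumptions A and B. Then there exists a nonempty Zariski open subset ℬ of ℂ^t such that for every η ∈ ℬ, the specialized system f(η,·) = (f_1(η,·),…,f_s(η,·)) generates a radical equidimensional ideal of ℂ[x] whose algebraic set is either empty or smooth of dimension d. -/
open MvPolynomial

noncomputable section

/-- The common zero locus in `F^σ` of a set of polynomials. -/
def zLocus {σ F : Type*} [CommSemiring F] (S : Set (MvPolynomial σ F)) : Set (σ → F) :=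
  {x | ∀ p ∈ S, eval x p = 0}

/-- The vanishing ideal of a subset of `F^σ`. -/
def vIdeal {σ F : Type*} [CommRing F] (V : Set (σ → F)) : Ideal (MvPolynomial σ F) where
  carrier := {p | ∀ x ∈ V, eval x p = 0}
  add_mem' := by
    intro p q hp hq x hx
    simp [hp x hx, hq x hx]
  zero_mem' := by intro x hx; simp
  smul_mem' := by
    intro c p hp x hx
    simp [smul_eq_mul, hp x hx]

/-- The dimension of an algebraic set, as the Krull dimension of its coordinate ring. -/
def setDim {σ : Type*} (V : Set (σ → ℂ)) : WithBot (WithTop ℕ) :=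
  ringKrullDim (MvPolynomial σ ℂ ⧸ vIdeal V)

/-- An ideal is equidimensional of dimension `d` if every minimal prime over it has
quotient of Krull dimension `d`. -/
def EquidimIdeal {R : Type*} [CommRing R] (I : Ideal R) (d : ℕ) : Prop :=
  ∀ P ∈ I.minimalPrimes, ringKrullDim (R ⧸ P) = (d : WithBot (WithTop ℕ))

/-- Differential at a point `p₀` of the polynomial `g`, applied to the vector `v`. -/
def polyDiff {σ : Type*} [Fintype σ] [DecidableEq σ] (p₀ : σ → ℂ) (g : MvPolynomial σ ℂ)
    (v : σ → ℂ) : ℂ :=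
  ∑ j, v j * eval p₀ (pderiv j g)

/-- The Zariski tangent space of `V` at `p₀`. -/
def tangentAt {σ : Type*} [Fintype σ] [DecidableEq σ] (V : Set (σ → ℂ)) (p₀ : σ → ℂ) :
    Submodule ℂ (σ → ℂ) where
  carrier := {v | ∀ g ∈ vIdeal V, polyDiff p₀ g v = 0}
  add_mem' := by
    intro a b ha hb g hg
    have h1 := ha g hg
    have h2 := hb g hg
    simp only [polyDiff, Pi.add_apply, add_mul, Finset.sum_add_distrib] at *
    simp [h1, h2]
  zero_mem' := by intro g hg; simp [polyDiff]
  smul_mem' := by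
    intro c a ha g hg
    have h1 := ha g hg
    simp only [polyDiff, Pi.smul_apply, smul_eq_mul, mul_assoc, ← Finset.mul_sum] at *
    simp [h1]

/-- The singular locus of `V`, relative to the expected dimension `d`:
points of `V` where the Zariski tangent space does not have dimension `d`. -/
def singLocus {σ : Type*} [Fintype σ] [DecidableEq σ] (V : Set (σ → ℂ)) (d : ℕ) :
    Set (σ → ℂ) :=
  {p | p ∈ V ∧ Module.finrank ℂ (tangentAt V p) ≠ d}

/-- Critical points of the polynomial map with components `φ` restricted to the
nonsingular locus of `V` (`V` of expected dimension `d`). -/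
def critMap {σ : Type*} [Fintype σ] [DecidableEq σ] {ι : Type*}
    (V : Set (σ → ℂ)) (d : ℕ) (φ : ι → MvPolynomial σ ℂ) : Set (σ → ℂ) :=
  {p | p ∈ V ∧ p ∉ singLocus V d ∧
    ¬ Function.Surjective (fun v : tangentAt V p => fun k : ι => polyDiff p (φ k) v)}

/-- The components of the projection on the first `i` coordinates, as polynomials. -/
def projPoly (n i : ℕ) : Fin i → MvPolynomial (Fin n) ℂ :=
  fun k => if h : (k : ℕ) < n then X ⟨k, h⟩ else 0

/-- Critical locus of the projection to the first `i` coordinates restricted to `V`,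
with the convention that for `i = d+1` it is all of `V`. -/
def critProj {n : ℕ} (V : Set (Fin n → ℂ)) (d i : ℕ) : Set (Fin n → ℂ) :=
  if i = d + 1 then V else critMap V d (projPoly n i)

/-- Projection of `ℂ^n` to the first `i` coordinates. -/
def projMap (n i : ℕ) (x : Fin n → ℂ) : Fin i → ℂ :=
  fun k => if h : (k : ℕ) < n then x ⟨k, h⟩ else 0

/-- `φ` restricted to `V` is proper at `β` (Euclidean topology). -/
def ProperAt {n i : ℕ} (φ : (Fin n → ℂ) → Fin i → ℂ) (V : Set (Fin n → ℂ))
    (β : Fin i → ℂ) : Prop :=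
  ∃ O : Set (Fin i → ℂ), IsOpen O ∧ β ∈ O ∧ IsCompact {x | x ∈ V ∧ φ x ∈ closure O}

/-- `φ` restricted to `V` is a proper map (onto its image). -/
def ProperOn {n i : ℕ} (φ : (Fin n → ℂ) → Fin i → ℂ) (V : Set (Fin n → ℂ)) : Prop :=
  ∀ β ∈ φ '' V, ProperAt φ V β

/-- Zariski open subsets of `F^k`: complements of zero loci of sets of polynomials. -/
def IsZariskiOpen {k : ℕ} {F : Type*} [CommSemiring F] (U : Set (Fin k → F)) : Prop :=
  ∃ S : Set (MvPolynomial (Fin k) F), U = {x | ∃ p ∈ S, eval x p ≠ 0}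

/-- Zariski open subsets of the space of `n × n` matrices over `F`. -/
def IsZariskiOpenMat {n : ℕ} {F : Type*} [CommSemiring F]
    (U : Set (Matrix (Fin n) (Fin n) F)) : Prop :=
  ∃ S : Set (MvPolynomial (Fin n × Fin n) F),
    U = {A | ∃ p ∈ S, eval (fun q => A q.1 q.2) p ≠ 0}

/-- Complexification of a rational polynomial. -/
def toC {σ : Type*} (p : MvPolynomial σ ℚ) : MvPolynomial σ ℂ :=
  MvPolynomial.map (algebraMap ℚ ℂ) p

/-- The change of variables `x ↦ A·x` acting on the `x`-variables only
(the `y`-variables are left invariant). -/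
def chgX {n t : ℕ} {F : Type*} [CommRing F] (A : Matrix (Fin n) (Fin n) F)
    (p : MvPolynomial (Fin n ⊕ Fin t) F) : MvPolynomial (Fin n ⊕ Fin t) F :=
  aeval (Sum.elim (fun j => ∑ k, C (A j k) * X (Sum.inl k)) (fun l => X (Sum.inr l))) p

/-- Specialization of the `y`-variables at the point `η`. -/
def specY {n t : ℕ} {F : Type*} [CommRing F] (η : Fin t → F)
    (p : MvPolynomial (Fin n ⊕ Fin t) F) : MvPolynomial (Fin n) F :=
  aeval (Sum.elim X (fun l => C (η l))) p

/-- Jacobian matrix w.r.t. the `x`-variables, evaluated at a point `z ∈ ℂ^{n+t}`. -/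
def jacXAt {n t s : ℕ} (f : Fin s → MvPolynomial (Fin n ⊕ Fin t) ℂ)
    (z : (Fin n ⊕ Fin t) → ℂ) : Matrix (Fin s) (Fin n) ℂ :=
  Matrix.of fun i j => eval z (pderiv (Sum.inl j) (f i))

/-- Symbolic Jacobian matrix of a polynomial system in the variables `x`. -/
def jacPoly {n s : ℕ} {F : Type*} [CommRing F] (g : Fin s → MvPolynomial (Fin n) F) :
    Matrix (Fin s) (Fin n) (MvPolynomial (Fin n) F) :=
  Matrix.of fun i j => pderiv j (g i)

/-- Symbolic Jacobian matrix w.r.t. the `x`-variables of a system in variables `(x,y)`. -/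
def jacPolyX {n t s : ℕ} {F : Type*} [CommRing F]
    (f : Fin s → MvPolynomial (Fin n ⊕ Fin t) F) :
    Matrix (Fin s) (Fin n) (MvPolynomial (Fin n ⊕ Fin t) F) :=
  Matrix.of fun i j => pderiv (Sum.inl j) (f i)

/-- The set of `k`-minors of `M` using only columns of index `≥ i` (0-indexed). -/
def minorsGE {s n : ℕ} {R : Type*} [CommRing R] (M : Matrix (Fin s) (Fin n) R)
    (k i : ℕ) : Set R :=
  {q | ∃ (r : Fin k → Fin s) (c : Fin k → Fin n), Function.Injective r ∧
        Function.Injective c ∧ (∀ l, i ≤ (c l : ℕ)) ∧ q = (M.submatrix r c).det}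

/-- Semi-algebraic formulas over `ℚ[y_1,…,y_t]`: boolean combinations of polynomial
sign conditions. -/
inductive SAForm (t : ℕ) : Type
  | eq (p : MvPolynomial (Fin t) ℚ) : SAForm t
  | pos (p : MvPolynomial (Fin t) ℚ) : SAForm t
  | nonneg (p : MvPolynomial (Fin t) ℚ) : SAForm t
  | ne (p : MvPolynomial (Fin t) ℚ) : SAForm t
  | conj (φ ψ : SAForm t) : SAForm t
  | disj (φ ψ : SAForm t) : SAForm t
  | neg (φ : SAForm t) : SAForm t

/-- Truth value of a semi-algebraic formula at a point of `ℝ^t`. -/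
def SAForm.holds {t : ℕ} : SAForm t → (Fin t → ℝ) → Prop
  | eq p, y => aeval y p = 0
  | pos p, y => 0 < aeval y p
  | nonneg p, y => 0 ≤ aeval y p
  | ne p, y => aeval y p ≠ 0
  | conj φ ψ, y => φ.holds y ∧ ψ.holds y
  | disj φ ψ, y => φ.holds y ∨ ψ.holds y
  | neg φ, y => ¬ φ.holds y

/-- The maximal total degree of the polynomials involved in a semi-algebraic formula. -/
def SAForm.deg {t : ℕ} : SAForm t → ℕ
  | eq p => p.totalDegree
  | pos p => p.totalDegree
  | nonneg p => p.totalDegree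
  | ne p => p.totalDegree
  | conj φ ψ => max φ.deg ψ.deg
  | disj φ ψ => max φ.deg ψ.deg
  | neg φ => φ.deg

/-- The solution set `Z(Φ) ⊆ ℝ^t` of a semi-algebraic formula. -/
def SAForm.zset {t : ℕ} (φ : SAForm t) : Set (Fin t → ℝ) := {y | φ.holds y}

/-- The real points of the variety defined by a rational system in variables `(x, y)`. -/
def realPts {n t s : ℕ} (f : Fin s → MvPolynomial (Fin n ⊕ Fin t) ℚ) :
    Set ((Fin n ⊕ Fin t) → ℝ) :=
  {z | ∀ i, aeval z (f i) = 0}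

/-- The real zero set of a set of rational polynomials. -/
def realZeros {σ : Type*} (S : Set (MvPolynomial σ ℚ)) : Set (σ → ℝ) :=
  {z | ∀ p ∈ S, aeval z p = 0}

/-- The projection `(x, y) ↦ y` on real points. -/
def projY {n t : ℕ} (z : (Fin n ⊕ Fin t) → ℝ) : Fin t → ℝ := z ∘ Sum.inr

/-- The projection `(x, y) ↦ y` on complex points. -/
def projYC {n t : ℕ} (z : (Fin n ⊕ Fin t) → ℂ) : Fin t → ℂ := z ∘ Sum.inr

/-- The complex algebraic set defined by a rational polynomial system. -/
def VC {n t s : ℕ} (f : Fin s → MvPolynomial (Fin n ⊕ Fin t) ℚ) :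
    Set ((Fin n ⊕ Fin t) → ℂ) :=
  zLocus (Set.range fun i => toC (f i))

/-- Assumption A: the ideal generated by `f` is radical, and its algebraic set is
(nonempty) equidimensional of dimension `d + t` with singular locus of dimension `< t`. -/
def AssumpA {n t s : ℕ} (f : Fin s → MvPolynomial (Fin n ⊕ Fin t) ℚ) (d : ℕ) : Prop :=
  (Ideal.span (Set.range f)).IsRadical ∧
  (VC f).Nonempty ∧
  EquidimIdeal (vIdeal (VC f)) (d + t) ∧
  setDim (singLocus (VC f) (d + t)) < (t : WithBot (WithTop ℕ))

/-- Assumption B: the Zariski closure of `π(V)` is all of `ℂ^t` (no nonzero polynomial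
vanishes on `π(V)`), and `π(V ∩ ℝ^{t+n})` has nonzero Lebesgue measure. -/
def AssumpB {n t s : ℕ} (f : Fin s → MvPolynomial (Fin n ⊕ Fin t) ℚ) : Prop :=
  (∀ p : MvPolynomial (Fin t) ℂ, (∀ z ∈ VC f, eval (projYC z) p = 0) → p = 0) ∧
  MeasureTheory.volume (projY '' realPts f) ≠ 0

/-- The conclusion of Lemma (B-param): the system `g` generates a radical
equidimensional ideal whose algebraic set is either empty or smooth of dimension `d`. -/
def GoodSpec {n s : ℕ} (g : Fin s → MvPolynomial (Fin n) ℂ) (d : ℕ) : Prop :=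
  (Ideal.span (Set.range g)).IsRadical ∧
  (zLocus (Set.range g) = ∅ ∨
    (EquidimIdeal (Ideal.span (Set.range g)) d ∧ singLocus (zLocus (Set.range g)) d = ∅))

/-- The field `ℚ(y_1, …, y_t)` of rational fractions. -/
abbrev RatFunc' (t : ℕ) : Type := FractionRing (MvPolynomial (Fin t) ℚ)

/-- View a polynomial of `ℚ[x, y]` as a polynomial of `ℚ(y)[x]`. -/
def toKx {n t : ℕ} (p : MvPolynomial (Fin n ⊕ Fin t) ℚ) :
    MvPolynomial (Fin n) (RatFunc' t) :=
  eval₂ ((C : RatFunc' t →+* MvPolynomial (Fin n) (RatFunc' t)).comp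
      ((algebraMap (MvPolynomial (Fin t) ℚ) (RatFunc' t)).comp (C : ℚ →+* MvPolynomial (Fin t) ℚ)))
    (Sum.elim X (fun l => C (algebraMap (MvPolynomial (Fin t) ℚ) (RatFunc' t) (X l)))) p

/-- Extension of a vector of `Fin d` to a function on `ℕ` (by zero). -/
def extFun {d : ℕ} {F : Type*} [Zero F] (α : Fin d → F) : ℕ → F :=
  fun k => if h : k < d then α ⟨k, h⟩ else 0

/-- The polynomial system `W_i^{A,α}` (over the ground field `F`, the change of
variables being already performed): the input equations, the `(n-d)`-minors of the
truncated Jacobian (except when `i = d+1`), and the equations `x_k = α_k`, `k ≤ i-1`. -/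
def Wsys {n s : ℕ} {F : Type*} [CommRing F] (g : Fin s → MvPolynomial (Fin n) F)
    (d i : ℕ) (a : ℕ → F) : Set (MvPolynomial (Fin n) F) :=
  Set.range g ∪ (if i = d + 1 then ∅ else minorsGE (jacPoly g) (n - d) i) ∪
  {q | ∃ k : Fin n, (k : ℕ) < i - 1 ∧ q = X k - C (a k)}

/-- The polynomial system `W_i^{A,α}` viewed in `ℚ[y][x]` (variables `(x,y)`). -/
def WsysXY {n t s : ℕ} (f : Fin s → MvPolynomial (Fin n ⊕ Fin t) ℚ)
    (d i : ℕ) (a : ℕ → ℚ) : Set (MvPolynomial (Fin n ⊕ Fin t) ℚ) :=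
  Set.range f ∪ (if i = d + 1 then ∅ else minorsGE (jacPolyX f) (n - d) i) ∪
  {q | ∃ k : Fin n, (k : ℕ) < i - 1 ∧ q = X (Sum.inl k) - C (a k)}

/-- A commutative ring is Cohen–Macaulay if, for every maximal ideal `m`, there is a
regular sequence contained in `m` of length the height of `m`. -/
def IsCMRing (R : Type*) [CommRing R] : Prop :=
  ∀ m : Ideal R, ∀ hm : m.IsMaximal, ∃ rs : List R,
    (∀ r ∈ rs, r ∈ m) ∧ RingTheory.Sequence.IsRegular R rs ∧
    (rs.length : WithBot (WithTop ℕ)) = ringKrullDim (@Localization.AtPrime R _ m hm.isPrime)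

/-- Homogenization of a polynomial w.r.t. all its variables, using a fresh variable. -/
def homog {σ : Type*} {F : Type*} [CommSemiring F] [DecidableEq σ] (p : MvPolynomial σ F) :
    MvPolynomial (σ ⊕ Unit) F :=
  p.support.sum fun m =>
    monomial (m.mapDomain Sum.inl +
        Finsupp.single (Sum.inr ()) (p.totalDegree - m.sum fun _ e => e)) (coeff m p)

/-- Zariski open subsets of the space `ℂ[x,y]^s_{≤D}` of `s`-tuples of polynomials of
total degree at most `D`, described by polynomial conditions on the coefficients. -/
def IsZariskiOpenTuple {n t : ℕ} (s D : ℕ)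
    (U : Set (Fin s → MvPolynomial (Fin n ⊕ Fin t) ℂ)) : Prop :=
  ∃ S : Set (MvPolynomial (Fin s × ((Fin n ⊕ Fin t) →₀ ℕ)) ℂ),
    U = {f | (∀ i, (f i).totalDegree ≤ D) ∧
          ∃ p ∈ S, eval (fun im => coeff im.2 (f im.1)) p ≠ 0}

/-- Zariski open subsets of the product of the space of `n×n` complex matrices with `ℂ^n`. -/
def IsZariskiOpenMatVec {n : ℕ}
    (U : Set (Matrix (Fin n) (Fin n) ℂ × (Fin n → ℂ))) : Prop :=
  ∃ S : Set (MvPolynomial ((Fin n × Fin n) ⊕ Fin n) ℂ),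
    U = {Aα | ∃ p ∈ S, eval (Sum.elim (fun q => Aα.1 q.1 q.2) Aα.2) p ≠ 0}



theorem exists_rows_of_le_rank {F m n : Type*} [Field F] [Fintype m] [Fintype n]
    (M : Matrix m n F) (k : ℕ) (h : k ≤ M.rank) :
    ∃ r : Fin k → m, LinearIndependent F (M.submatrix r id).row := by
  rw [Matrix.rank_eq_finrank_span_row] at h
  obtain ⟨κ, a, ha, hs, hli⟩ := exists_linearIndependent' F M.row
  have : Finite κ := Finite.of_injective a ha
  have := Fintype.ofFinite κ
  have hc : k ≤ Fintype.card κ := by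
    rw [← hs, finrank_span_eq_card hli] at h
    exact h
  obtain ⟨e⟩ : Nonempty (Fin k ↪ κ) :=
    Function.Embedding.nonempty_of_card_le (by simpa using hc)
  exact ⟨a ∘ e, hli.comp e e.injective⟩

/-- rank at least `k` iff some minor does not vanish -/
theorem le_rank_iff_minor {F m n : Type*} [Field F] [Fintype m] [Fintype n]
    (M : Matrix m n F) (k : ℕ) :
    k ≤ M.rank ↔ ∃ (r : Fin k → m) (c : Fin k → n), (M.submatrix r c).det ≠ 0 := by
  classical
  constructor
  · intro h
    obtain ⟨r, hr⟩ := exists_rows_of_le_rank M k h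
    have h2 : k ≤ (M.submatrix r id).transpose.rank := by
      rw [Matrix.rank_transpose, hr.rank_matrix]; simp
    obtain ⟨c, hc⟩ := exists_rows_of_le_rank _ k h2
    refine ⟨r, c, ?_⟩
    have : IsUnit ((M.submatrix r id).transpose.submatrix c id) :=
      Matrix.linearIndependent_rows_iff_isUnit.mp hc
    rw [Matrix.isUnit_iff_isUnit_det] at this
    have h3 := this.ne_zero
    rwa [← Matrix.det_transpose] at h3
  · rintro ⟨r, c, h⟩
    have := Matrix.rank_of_det_ne_zero h
    rw [Fintype.card_fin] at this
    rw [← this]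
    exact Matrix.rank_submatrix_le _ _ _

theorem height_maximal_mvPoly (k : Type*) [Field k] (s : ℕ) (m : Ideal (MvPolynomial (Fin s) k))
    [hm : m.IsMaximal] : m.height = s := by
  induction s with
  | zero =>
    have : m.height ≤ 0 := by
      have h1 := Ideal.height_le_ringKrullDim_of_ne_top hm.ne_top
      rw [MvPolynomial.ringKrullDim_of_isNoetherianRing, ringKrullDim_eq_zero_of_field] at h1
      simp at h1
      simp [h1]
    simpa using this
  | succ s ih =>
    let e := (MvPolynomial.finSuccEquiv k s).toRingEquiv
    let P : Ideal (Polynomial (MvPolynomial (Fin s) k)) := m.comap e.symm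
    have : P.IsMaximal := Ideal.comap_isMaximal_of_surjective _ e.symm.surjective
    let p := P.comap (Polynomial.C)
    have hp : p.IsMaximal := Polynomial.isMaximal_comap_C_of_isJacobsonRing P
    have : P.LiesOver p := ⟨rfl⟩
    have h1 := Polynomial.height_eq_height_add_one p P
    rw [ih p] at h1
    have : P.height = m.height := RingEquiv.height_comap e.symm m
    rw [← this, h1]; simp

theorem height_maximal_domain (k S : Type*) [Field k] [CommRing S] [IsDomain S] [Algebra k S]
    [Algebra.FiniteType k S] (m : Ideal S) [hm : m.IsMaximal] :
    (m.height : WithBot ℕ∞) = ringKrullDim S := by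
  apply le_antisymm (Ideal.height_le_ringKrullDim_of_ne_top hm.ne_top)
  obtain ⟨s, g, hg, hi⟩ := exists_integral_inj_algHom_of_fg k S
  have : IsNoetherianRing S := Algebra.FiniteType.isNoetherianRing k S
  algebraize [g.toRingHom]
  have : FaithfulSMul (MvPolynomial (Fin s) k) S := (faithfulSMul_iff_algebraMap_injective _ _).mpr hg
  let n := m.under (MvPolynomial (Fin s) k)
  have hn : n.IsMaximal := Ideal.isMaximal_comap_of_isIntegral_of_isMaximal m
  have h1 : m.height = n.height + _ := Ideal.height_eq_height_add_of_liesOver_of_hasGoingDown n m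
  rw [height_maximal_mvPoly] at h1
  have h2 : ringKrullDim S ≤ ringKrullDim (MvPolynomial (Fin s) k) := by
    apply Order.krullDim_le_of_strictMono (PrimeSpectrum.comap (algebraMap (MvPolynomial (Fin s) k) S))
    intro P Q h
    exact Ideal.IsIntegral.comap_lt_comap (R := MvPolynomial (Fin s) k) (I := P.asIdeal) (J := Q.asIdeal) h
  rw [MvPolynomial.ringKrullDim_of_isNoetherianRing, ringKrullDim_eq_zero_of_field] at h2
  refine h2.trans ?_
  rw [h1]
  simp only [zero_add, Nat.card_eq_fintype_card, Fintype.card_fin]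
  exact WithBot.coe_le_coe.mpr (le_self_add : (s : ℕ∞) ≤ _)

universe u

theorem isDomain_of_regular (d : ℕ) : ∀ (S : Type u) [CommRing S] [IsLocalRing S] [IsNoetherianRing S]
    (_ : (d : WithBot ℕ∞) ≤ ringKrullDim S) (s : Fin d → S)
    (_ : Ideal.span (Set.range s) = IsLocalRing.maximalIdeal S), IsDomain S := by
  induction d with
  | zero =>
    intro S _ _ _ _ s hs
    have h0 : IsLocalRing.maximalIdeal S = ⊥ := by
      rw [← hs]; simp
    have : (⊥ : Ideal S).IsPrime := h0 ▸ inferInstance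
    exact IsDomain.of_bot_isPrime S
  | succ d ih =>
    intro S _ _ _ hd s hs
    set m := IsLocalRing.maximalIdeal S with hm
    have hfin : (minimalPrimes S).Finite := minimalPrimes.finite_of_isNoetherianRing S
    have hdm : ((d + 1 : ℕ) : ℕ∞) ≤ m.height := by
      rw [← IsLocalRing.maximalIdeal_height_eq_ringKrullDim] at hd
      exact_mod_cast hd
    have hmin : m ∉ minimalPrimes S := by
      intro h
      have : m.height = 0 := Ideal.height_eq_zero_iff.mpr h
      rw [this] at hdm
      simp at hdm
    have hav : ¬ ((m : Set S) ⊆ ⋃ i ∈ (insert (m ^ 2) hfin.toFinset : Finset (Ideal S)), (i : Set S)) := by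
      classical
      intro h
      have hp : ∀ i ∈ (insert (m ^ 2) hfin.toFinset : Finset (Ideal S)), i ≠ m ^ 2 → i ≠ m ^ 2 →
          ((id i : Ideal S)).IsPrime := by
        intro i hi h1 h2
        rw [Finset.mem_insert] at hi
        have hi' : i ∈ minimalPrimes S := by simpa [h1] using hi
        exact hi'.1.1
      have h := (Ideal.subset_union_prime (f := id) (m ^ 2) (m ^ 2) hp (I := m)).mp h
      · obtain ⟨i, hi, hle⟩ := h
        rw [Finset.mem_insert] at hi
        rcases hi with rfl | hi
        · have hb : m = ⊥ := by
            apply Submodule.eq_bot_of_le_smul_of_le_jacobson_bot m m (IsNoetherian.noetherian _)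
            · rw [smul_eq_mul, ← pow_two]; exact hle
            · exact IsLocalRing.maximalIdeal_le_jacobson _
          apply hmin
          have : (⊥ : Ideal S).IsPrime := hb ▸ (inferInstance : m.IsPrime)
          rw [hb]
          exact ⟨⟨this, le_rfl⟩, fun _ _ _ => bot_le⟩
        · have hi' : i ∈ minimalPrimes S := by simpa using hi
          have : i.IsPrime := hi'.1.1
          have : i = m := le_antisymm (IsLocalRing.le_maximalIdeal this.ne_top) hle
          exact hmin (this ▸ hi')
    rw [Set.not_subset] at hav
    obtain ⟨x, hxm, hx⟩ := hav
    have hx2 : x ∉ m ^ 2 := fun h => hx (by simp [h])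
    have hx3 : ∀ Q ∈ minimalPrimes S, x ∉ Q := fun Q hQ h => hx (by
      simp only [Set.mem_iUnion]
      exact ⟨Q, by simp [hQ], h⟩)
    have hxs : x ∈ Ideal.span (Set.range s) := hs ▸ hxm
    obtain ⟨a, ha⟩ := (Ideal.mem_span_range_iff_exists_fun).mp hxs
    have hsm : ∀ i, s i ∈ m := fun i => hs ▸ Ideal.subset_span ⟨i, rfl⟩
    obtain ⟨i, hi⟩ : ∃ i, a i ∉ m := by
      by_contra! h
      apply hx2
      rw [← ha, pow_two]
      exact Ideal.sum_mem _ fun i _ => Ideal.mul_mem_mul (h i) (hsm i)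
    have hu : IsUnit (a i) := by
      by_contra h
      exact hi ((IsLocalRing.mem_maximalIdeal _).mpr h)
    obtain ⟨b, hb⟩ := hu.exists_left_inv
    have hspan : Ideal.span {x} ≠ ⊤ := by
      intro h
      have : Ideal.span {x} ≤ m := by rw [Ideal.span_le]; simpa using hxm
      exact (inferInstance : m.IsPrime).ne_top (top_le_iff.mp (h ▸ this))
    let T := S ⧸ Ideal.span {x}
    have : Nontrivial T := Ideal.Quotient.nontrivial_iff.mpr hspan
    have : IsLocalRing T := IsLocalRing.of_surjective' (Ideal.Quotient.mk _) Ideal.Quotient.mk_surjective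
    have hT : IsDomain T := by
      refine ih T ?_ (fun j => Ideal.Quotient.mk _ (s (i.succAbove j))) ?_
      · have h1 := ringKrullDim_le_ringKrullDim_quotient_add_card (R := S) {x}
          (by
            rw [IsLocalRing.ringJacobson_eq_maximalIdeal]
            intro z hz
            rw [Finset.mem_coe, Finset.mem_singleton] at hz
            exact hz ▸ hxm)
        have h0 : (((({x} : Finset S)) : Set S)) = {x} := Finset.coe_singleton x
        rw [h0] at h1
        simp only [Finset.card_singleton] at h1
        have h2 := hd.trans h1
        push_cast at h2
        exact (ENat.WithBot.add_le_add_one_right_iff).mp h2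
      · have hmT : IsLocalRing.maximalIdeal T = m.map (Ideal.Quotient.mk _) := by
          exact (IsLocalRing.map_maximalIdeal_of_surjective _ Ideal.Quotient.mk_surjective).symm
        rw [hmT, ← hs, Ideal.map_span, ← Set.range_comp]
        apply le_antisymm
        · rw [Ideal.span_le]
          rintro _ ⟨j, rfl⟩
          exact Ideal.subset_span ⟨i.succAbove j, rfl⟩
        · rw [Ideal.span_le]
          rintro _ ⟨j, rfl⟩
          rcases Fin.eq_self_or_eq_succAbove i j with rfl | ⟨j, rfl⟩
          · rw [Fin.sum_univ_succAbove _ j] at ha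
            have hz : Ideal.Quotient.mk (Ideal.span {x}) x = 0 :=
              Ideal.Quotient.eq_zero_iff_mem.mpr (Ideal.subset_span rfl)
            have : Ideal.Quotient.mk (Ideal.span {x}) (s j) =
               - ∑ l, Ideal.Quotient.mk (Ideal.span {x}) (b * a (j.succAbove l)) *
                 Ideal.Quotient.mk (Ideal.span {x}) (s (j.succAbove l)) := by
              have e1 : s j = b * x - ∑ l, (b * a (j.succAbove l)) * s (j.succAbove l) := by
                rw [← ha, mul_add, Finset.mul_sum, ← mul_assoc, hb]
                simp [mul_assoc]
              rw [e1]
              simp [hz]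
            simp only [Function.comp]
            rw [this]
            apply neg_mem
            exact Ideal.sum_mem _ fun l _ => Ideal.mul_mem_left _ _ (Ideal.subset_span ⟨l, rfl⟩)
          · exact Ideal.subset_span ⟨j, rfl⟩
    have hP : (Ideal.span {x}).IsPrime := (Ideal.Quotient.isDomain_iff_prime _).mp hT
    obtain ⟨Q, hQ, hQx⟩ := Ideal.exists_minimalPrimes_le (I := (⊥ : Ideal S)) (J := Ideal.span {x}) bot_le
    have hQp : Q.IsPrime := hQ.1.1
    have hQ0 : Q = ⊥ := by
      apply Submodule.eq_bot_of_le_smul_of_le_jacobson_bot m Q (IsNoetherian.noetherian _)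
      · intro q hq
        obtain ⟨c, hc⟩ := Ideal.mem_span_singleton'.mp (hQx hq)
        have : c ∈ Q := by
          rw [← hc] at hq
          exact (hQp.mem_or_mem hq).resolve_right (hx3 Q hQ)
        rw [← hc, mul_comm]
        exact Submodule.smul_mem_smul hxm this
      · exact IsLocalRing.maximalIdeal_le_jacobson _
    have : (⊥ : Ideal S).IsPrime := hQ0 ▸ hQp
    exact IsDomain.of_bot_isPrime S

theorem vIdeal_zLocus_eq {σ : Type*} [Finite σ] (S : Set (MvPolynomial σ ℂ)) :
    vIdeal (zLocus S) = (Ideal.span S).radical := by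
  rw [← MvPolynomial.vanishingIdeal_zeroLocus_eq_radical (K := ℂ)]
  ext p
  rw [mem_vanishingIdeal_iff, MvPolynomial.zeroLocus_span]
  rfl

theorem polyDiff_mem_span {σ : Type*} [Fintype σ] [DecidableEq σ] {S : Set (MvPolynomial σ ℂ)}
    {z : σ → ℂ} (hz : z ∈ zLocus S) (v : σ → ℂ) (hv : ∀ g ∈ S, polyDiff z g v = 0)
    (g : MvPolynomial σ ℂ) (hg : g ∈ Ideal.span S) : polyDiff z g v = 0 ∧ eval z g = 0 := by
  induction hg using Submodule.span_induction with
  | mem x h => exact ⟨hv x h, hz x h⟩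
  | zero => simp [polyDiff]
  | add x y _ _ hx hy =>
    refine ⟨?_, by simp [hx.2, hy.2]⟩
    have := congrArg₂ (· + ·) hx.1 hy.1
    simpa [polyDiff, mul_add, Finset.sum_add_distrib] using this
  | smul a x _ hx =>
    refine ⟨?_, by simp [hx.2]⟩
    have := congrArg (fun w => eval z a * w) hx.1
    simp only [polyDiff, Finset.mul_sum, mul_zero] at this
    simp only [polyDiff, smul_eq_mul, Derivation.leibniz, map_add, map_mul, hx.2]
    refine Eq.trans ?_ this
    refine Finset.sum_congr rfl fun j _ => by ring

theorem finrank_tangentAt {σ : Type*} [Fintype σ] [DecidableEq σ] {s : ℕ}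
    (g : Fin s → MvPolynomial σ ℂ) (hI : (Ideal.span (Set.range g)).IsRadical)
    {z : σ → ℂ} (hz : z ∈ zLocus (Set.range g)) :
    Module.finrank ℂ (tangentAt (zLocus (Set.range g)) z) +
      (Matrix.of fun i j => eval z (pderiv j (g i)) : Matrix (Fin s) σ ℂ).rank
      = Fintype.card σ := by
  set J := (Matrix.of fun i j => eval z (pderiv j (g i)) : Matrix (Fin s) σ ℂ)
  have h1 : tangentAt (zLocus (Set.range g)) z = LinearMap.ker J.mulVecLin := by
    ext v
    have e : ∀ i, J.mulVec v i = polyDiff z (g i) v := by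
      intro i
      simp only [Matrix.mulVec, dotProduct, polyDiff, J, Matrix.of_apply]
      exact Finset.sum_congr rfl fun j _ => mul_comm _ _
    rw [LinearMap.mem_ker, Matrix.mulVecLin_apply]
    constructor
    · intro hv
      ext i
      rw [e]
      refine hv _ ?_
      rw [vIdeal_zLocus_eq]
      exact Ideal.le_radical (Ideal.subset_span ⟨i, rfl⟩)
    · intro hv p hp
      rw [vIdeal_zLocus_eq, hI.radical] at hp
      refine (polyDiff_mem_span hz v ?_ p hp).1
      rintro _ ⟨i, rfl⟩
      rw [← e, hv]; rfl
  rw [h1]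
  have := LinearMap.finrank_range_add_finrank_ker J.mulVecLin
  rw [Module.finrank_fintype_fun_eq_card] at this
  rw [← this, add_comm]
  rfl


theorem descent_galois {σ k L : Type*} [Field k] [Field L] [Algebra k L] [IsGalois k L]
    (W I' : Ideal (MvPolynomial σ L))
    (hW : ∀ τ : L ≃ₐ[k] L, ∀ h ∈ W, MvPolynomial.map (τ : L →+* L) h ∈ W)
    (hI : ∀ p : MvPolynomial σ k, MvPolynomial.map (algebraMap k L) p ∈ W →
      MvPolynomial.map (algebraMap k L) p ∈ I') : W ≤ I' := by
  classical
  have key : ∀ N : ℕ, ∀ h ∈ W, h.support.card = N → h ∈ I' := by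
    intro N
    induction N using Nat.strong_induction_on with
    | _ N ih =>
    intro h hh hN
    by_cases h0 : h = 0
    · rw [h0]; exact I'.zero_mem
    obtain ⟨m0, hm0⟩ := (MvPolynomial.ne_zero_iff).mp h0
    -- normalise
    obtain ⟨h', hh'⟩ : ∃ h', h' = C (coeff m0 h)⁻¹ * h := ⟨_, rfl⟩
    have hW' : h' ∈ W := hh' ▸ W.mul_mem_left _ hh
    have hc0 : coeff m0 h' = 1 := by rw [hh', coeff_C_mul, inv_mul_cancel₀ hm0]
    have hsupp : ∀ m, coeff m h = 0 ↔ coeff m h' = 0 := by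
      intro m; rw [hh', coeff_C_mul]; simp [hm0]
    suffices h' ∈ I' by
      have e : h = C (coeff m0 h) * h' := by
        rw [hh', ← mul_assoc, ← C_mul, mul_inv_cancel₀ hm0]; simp
      rw [e]; exact I'.mul_mem_left _ this
    by_cases hall : ∀ m, coeff m h' ∈ Set.range (algebraMap k L)
    · have : h' ∈ Set.range (MvPolynomial.map (σ := σ) (algebraMap k L)) := by
        rw [MvPolynomial.mem_range_map_iff_coeffs_subset]
        intro c hc
        obtain ⟨m, _, rfl⟩ := MvPolynomial.mem_coeffs_iff.mp hc
        exact hall m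
      obtain ⟨p, hp⟩ := this
      rw [← hp]
      exact hI p (hp ▸ hW')
    · push Not at hall
      obtain ⟨m, hm⟩ := hall
      obtain ⟨τ, hτ⟩ : ∃ τ : L ≃ₐ[k] L, τ (coeff m h') ≠ coeff m h' := by
        by_contra! hcon
        exact hm ((InfiniteGalois.mem_range_algebraMap_iff_fixed _).mpr hcon)
      set g := MvPolynomial.map (τ : L →+* L) h' - h' with hg
      have hgc : ∀ m, coeff m g = τ (coeff m h') - coeff m h' := by
        intro m; simp [hg, coeff_map]
      have hgW : g ∈ W := W.sub_mem (hW τ _ hW') hW'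
      have hlt : ∀ q : MvPolynomial σ L, ∀ m1, coeff m1 h' ≠ 0 → coeff m1 q = 0 →
          (∀ m, coeff m h' = 0 → coeff m q = 0) → q.support.card < N := by
        intro q m1 hm1 hq1 hq
        rw [← hN]
        apply Finset.card_lt_card
        rw [Finset.ssubset_iff_of_subset]
        · refine ⟨m1, ?_, ?_⟩
          · rw [mem_support_iff]; exact fun h => hm1 ((hsupp _).mp h)
          · rw [mem_support_iff]; exact not_not.mpr hq1
        · intro a ha
          rw [mem_support_iff] at ha ⊢
          exact fun h => ha (hq _ ((hsupp _).mp h))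
      have hgI : g ∈ I' := by
        refine ih _ (hlt g m0 ?_ ?_ ?_) g hgW rfl
        · rw [hc0]; exact one_ne_zero
        · rw [hgc, hc0]; simp
        · intro a ha; rw [hgc, ha]; simp
      have hgm : coeff m g ≠ 0 := by rw [hgc]; exact sub_ne_zero.mpr hτ
      set q := h' - C (coeff m h' / coeff m g) * g with hq
      have hqI : q ∈ I' := by
        refine ih _ (hlt q m ?_ ?_ ?_) q (W.sub_mem hW' (W.mul_mem_left _ hgW)) rfl
        · intro h; rw [h] at hm; exact hm ⟨0, by simp⟩
        · rw [hq, coeff_sub, coeff_C_mul, div_mul_cancel₀ _ hgm, sub_self]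
        · intro a ha; rw [hq, coeff_sub, coeff_C_mul, hgc a, ha]; simp
      have : h' = q + C (coeff m h' / coeff m g) * g := by rw [hq]; ring
      rw [this]
      exact I'.add_mem hqI (I'.mul_mem_left _ hgI)
  exact fun h hh => key _ h hh rfl

theorem descent_linear {σ L K : Type*} [Field L] [Field K] [Algebra L K]
    (I' : Ideal (MvPolynomial σ L)) (V : Set (σ → L))
    (hI : ∀ p : MvPolynomial σ L, (∀ x ∈ V, eval x p = 0) → p ∈ I')
    (h : MvPolynomial σ K) (hh : ∀ x ∈ V, eval (fun i => algebraMap L K (x i)) h = 0) :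
    h ∈ I'.map (MvPolynomial.map (algebraMap L K)) := by
  classical
  let b := Module.Basis.ofVectorSpace L K
  let S := h.support.biUnion (fun m => (b.repr (coeff m h)).support)
  let φ : _ → MvPolynomial σ L := fun i => ∑ m ∈ h.support, monomial m (b.repr (coeff m h) i)
  have hφ : ∀ i, φ i ∈ I' := by
    intro i
    apply hI
    intro x hx
    have h1 := hh x hx
    rw [eval_eq] at h1
    have h2 := congrArg (fun c => b.repr c i) h1
    simp only [map_sum, Finsupp.coe_finsetSum, Finset.sum_apply, map_zero, Finsupp.coe_zero,
      Pi.zero_apply] at h2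
    simp only [φ, map_sum, eval_monomial]
    rw [← h2]
    refine Finset.sum_congr rfl fun m _ => ?_
    have : coeff m h * ∏ i ∈ m.support, algebraMap L K (x i) ^ m i
      = (∏ i ∈ m.support, x i ^ m i) • coeff m h := by
      rw [Algebra.smul_def, mul_comm]; simp
    rw [this, map_smul, Finsupp.smul_apply, smul_eq_mul, mul_comm]
    rfl
  have e : h = ∑ i ∈ S, C (b i) * MvPolynomial.map (algebraMap L K) (φ i) := by
    simp only [φ, map_sum, map_monomial, Finset.mul_sum, C_mul_monomial]
    rw [Finset.sum_comm]
    conv_lhs => rw [h.as_sum]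
    refine Finset.sum_congr rfl fun m hm => ?_
    rw [← map_sum]
    congr 1
    conv_lhs => rw [← b.linearCombination_repr (coeff m h), Finsupp.linearCombination_apply]
    rw [Finsupp.sum_of_support_subset (s := S)]
    · refine Finset.sum_congr rfl fun i _ => ?_
      rw [Algebra.smul_def, mul_comm]
    · exact Finset.subset_biUnion_of_mem (fun m => (b.repr (coeff m h)).support) hm
    · simp
  rw [e]
  exact Ideal.sum_mem _ fun i _ => Ideal.mul_mem_left _ _ (Ideal.mem_map_of_mem _ (hφ i))

theorem radical_toC_aux (L : Type) [Field L] [Algebra ℚ L] [Algebra L ℂ] [IsScalarTower ℚ L ℂ]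
    [IsGalois ℚ L] [IsAlgClosed L] {σ : Type*} [Finite σ] {s : ℕ} (f : Fin s → MvPolynomial σ ℚ)
    (hf : (Ideal.span (Set.range f)).IsRadical) :
    (Ideal.span (Set.range fun i => toC (f i))).IsRadical := by
  set I := Ideal.span (Set.range f) with hIdef
  let IL : Ideal (MvPolynomial σ L) := I.map (MvPolynomial.map (algebraMap ℚ L))
  have hIC : Ideal.span (Set.range fun i => toC (f i)) =
      IL.map (MvPolynomial.map (algebraMap L ℂ)) := by
    simp only [IL]
    rw [Ideal.map_map, hIdef, Ideal.map_span, ← Set.range_comp]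
    congr 1
    ext p
    constructor
    · rintro ⟨i, rfl⟩
      refine ⟨i, ?_⟩
      simp only [Function.comp, RingHom.comp_apply, MvPolynomial.map_map, toC]
      rw [IsScalarTower.algebraMap_eq ℚ L ℂ]
    · rintro ⟨i, rfl⟩
      refine ⟨i, ?_⟩
      simp only [Function.comp, RingHom.comp_apply, MvPolynomial.map_map, toC]
      rw [IsScalarTower.algebraMap_eq ℚ L ℂ]
  have hq : ∀ p : MvPolynomial σ ℚ, (∀ x ∈ zeroLocus L I, aeval x p = 0) → p ∈ I := by
    intro p hp
    have : p ∈ vanishingIdeal ℚ (zeroLocus L I) := mem_vanishingIdeal_iff.mpr hp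
    rwa [MvPolynomial.vanishingIdeal_zeroLocus_eq_radical, hf.radical] at this
  let W : Ideal (MvPolynomial σ L) := vIdeal (zeroLocus L I)
  have hW : W ≤ IL := by
    apply descent_galois (k := ℚ)
    · intro τ h hh x hx
      have h1 : (fun i => τ.symm (x i)) ∈ zeroLocus L I := by
        intro p hp
        have := hx p hp
        have e : aeval (fun i => τ.symm (x i)) p = τ.symm (aeval x p) := by
          rw [← AlgEquiv.coe_toAlgHom, ← AlgHom.comp_apply]
          rw [comp_aeval]
        rw [e, this, map_zero]
      have h2 := congrArg τ (hh _ h1)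
      rw [map_zero] at h2
      rw [← h2, eval_map]
      have : τ (eval (fun i => τ.symm (x i)) h) = (τ : L →+* L) (eval (fun i => τ.symm (x i)) h) := rfl
      rw [this, eval, coe_eval₂Hom, hom_eval₂]
      simp only [RingHom.comp_id]
      congr 1
      ext i
      simp
    · intro p hp
      apply Ideal.mem_map_of_mem
      apply hq
      intro x hx
      have := hp x hx
      rwa [eval_map, ← aeval_def] at this
  rw [hIC]
  intro h hh
  apply descent_linear _ (zeroLocus L I) (fun p hp => hW hp)
  intro x hx
  rw [← hIC, ← vIdeal_zLocus_eq] at hh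
  apply hh
  rintro _ ⟨i, rfl⟩
  have := hx (f i) (Ideal.subset_span ⟨i, rfl⟩)
  have h3 := congrArg (algebraMap L ℂ) this
  rw [map_zero] at h3
  rw [← h3]
  simp only [toC]
  rw [eval_map, aeval_def, hom_eval₂, ← IsScalarTower.algebraMap_eq ℚ L ℂ]

theorem algebraicClosure_isGalois (k : Type*) [Field k] [CharZero k] :
    IsGalois k (AlgebraicClosure k) := inferInstance

theorem radical_toC {σ : Type*} [Finite σ] {s : ℕ} (f : Fin s → MvPolynomial σ ℚ)
    (hf : (Ideal.span (Set.range f)).IsRadical) :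
    (Ideal.span (Set.range fun i => toC (f i))).IsRadical := by
  have h1 : IsGalois ℚ (AlgebraicClosure ℚ) := by
    convert! algebraicClosure_isGalois ℚ
  have h2 : Algebra.IsAlgebraic ℚ (AlgebraicClosure ℚ) := inferInstance
  let : Algebra (AlgebraicClosure ℚ) ℂ :=
    (IsAlgClosed.lift : AlgebraicClosure ℚ →ₐ[ℚ] ℂ).toRingHom.toAlgebra
  have : IsScalarTower ℚ (AlgebraicClosure ℚ) ℂ := IsScalarTower.of_algebraMap_eq fun x =>
    ((IsAlgClosed.lift : AlgebraicClosure ℚ →ₐ[ℚ] ℂ).commutes x).symm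
  exact radical_toC_aux (AlgebraicClosure ℚ) f hf


theorem le_dim_of_inj (D : Type) [CommRing D] [IsDomain D] [Algebra ℂ D] [Algebra.FiniteType ℂ D]
    (t : ℕ) (φ : MvPolynomial (Fin t) ℂ →ₐ[ℂ] D) (hφ : Function.Injective φ) :
    (t : WithBot ℕ∞) ≤ ringKrullDim D := by
  obtain ⟨s, g, hg, hi⟩ := exists_integral_inj_algHom_of_fg ℂ D
  have h1 : (s : WithBot ℕ∞) ≤ ringKrullDim D := by
    have : IsNoetherianRing D := Algebra.FiniteType.isNoetherianRing ℂ D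
    algebraize [g.toRingHom]
    have : FaithfulSMul (MvPolynomial (Fin s) ℂ) D := (faithfulSMul_iff_algebraMap_injective _ _).mpr hg
    obtain ⟨m, hm⟩ := Ideal.exists_maximal D
    rw [← height_maximal_domain ℂ D m]
    let n := m.under (MvPolynomial (Fin s) ℂ)
    have hn : n.IsMaximal := Ideal.isMaximal_comap_of_isIntegral_of_isMaximal m
    have h1 : m.height = n.height + _ := Ideal.height_eq_height_add_of_liesOver_of_hasGoingDown n m
    rw [height_maximal_mvPoly] at h1
    rw [h1]
    exact WithBot.coe_le_coe.mpr (le_self_add : (s : ℕ∞) ≤ _)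
  refine le_trans ?_ h1
  have h2 : (t : Cardinal) ≤ Algebra.trdeg ℂ D := by
    have : AlgebraicIndependent ℂ (fun i => φ (X i)) := by
      have := (MvPolynomial.algebraicIndependent_X (Fin t) ℂ).map' hφ
      exact this
    simpa using this.cardinalMk_le_trdeg
  have h3 : (s : Cardinal) = Algebra.trdeg ℂ D := by
    algebraize [g.toRingHom]
    have : IsScalarTower ℂ (MvPolynomial (Fin s) ℂ) D := IsScalarTower.of_algebraMap_eq fun x =>
      (g.commutes x).symm
    have : FaithfulSMul (MvPolynomial (Fin s) ℂ) D := (faithfulSMul_iff_algebraMap_injective _ _).mpr hg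
    have h4 := (IsTranscendenceBasis.mvPolynomial (Fin s) ℂ).algebraMap_comp (A := D)
    simpa using h4.cardinalMk_eq_trdeg
  rw [← h3] at h2
  exact_mod_cast h2

/-- The set of nonzero polynomials in the parameters, as a submonoid of `ℂ[x,y]`. -/
def paramMonoid (n t : ℕ) : Submonoid (MvPolynomial (Fin n ⊕ Fin t) ℂ) :=
  (nonZeroDivisors (MvPolynomial (Fin t) ℂ)).map
    (rename Sum.inr : MvPolynomial (Fin t) ℂ →ₐ[ℂ] MvPolynomial (Fin n ⊕ Fin t) ℂ)

theorem exists_prime_or_param {n t : ℕ} (I : Ideal (MvPolynomial (Fin n ⊕ Fin t) ℂ)) :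
    (∃ p : MvPolynomial (Fin t) ℂ, p ≠ 0 ∧ rename Sum.inr p ∈ I) ∨
    ∃ Q : Ideal (MvPolynomial (Fin n ⊕ Fin t) ℂ), Q.IsPrime ∧ I ≤ Q ∧
      ∀ p : MvPolynomial (Fin t) ℂ, rename Sum.inr p ∈ Q → p = 0 := by
  by_cases h : ∃ p : MvPolynomial (Fin t) ℂ, p ≠ 0 ∧ rename Sum.inr p ∈ I
  · exact Or.inl h
  right
  push Not at h
  have hd : Disjoint (I : Set (MvPolynomial (Fin n ⊕ Fin t) ℂ)) (paramMonoid n t) := by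
    rw [Set.disjoint_left]
    rintro _ hx ⟨p, hp, rfl⟩
    exact h p (nonZeroDivisors.ne_zero hp) hx
  obtain ⟨Q, hQ, hIQ, hdis⟩ := Ideal.exists_le_prime_disjoint I _ hd
  refine ⟨Q, hQ, hIQ, fun p hp => ?_⟩
  by_contra h0
  exact Set.disjoint_left.mp hdis hp ⟨p, mem_nonZeroDivisors_of_ne_zero h0, rfl⟩

theorem exists_param_of_setDim_lt {n t : ℕ} (Z : Set ((Fin n ⊕ Fin t) → ℂ))
    (hZ : setDim Z < (t : WithBot (WithTop ℕ))) :
    ∃ p : MvPolynomial (Fin t) ℂ, p ≠ 0 ∧ rename Sum.inr p ∈ vIdeal Z := by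
  rcases exists_prime_or_param (vIdeal Z) with h | ⟨Q, hQ, hIQ, hp⟩
  · exact h
  exfalso
  refine absurd hZ (not_lt.mpr ?_)
  have h1 := le_dim_of_inj (MvPolynomial (Fin n ⊕ Fin t) ℂ ⧸ Q) t
    ((Ideal.Quotient.mkₐ ℂ Q).comp (rename Sum.inr)) (by
      rw [injective_iff_map_eq_zero]
      intro p hp'
      exact hp p (Ideal.Quotient.eq_zero_iff_mem.mp hp'))
  refine le_trans h1 ?_
  exact ringKrullDim_le_of_surjective (Ideal.Quotient.factor hIQ) (Ideal.Quotient.factor_surjective hIQ)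


theorem formallySmooth_lift {A κ B : Type} [CommRing A] [CommRing κ] [CommRing B] [Algebra A κ]
    [Algebra.FormallySmooth A κ] (g : B →+* κ) (hg : Function.Surjective g)
    (hn : IsNilpotent (RingHom.ker g)) (a : A →+* B) (h : g.comp a = algebraMap A κ) :
    ∃ Φ : κ →+* B, (∀ x, g (Φ x) = x) ∧ ∀ y, Φ (algebraMap A κ y) = a y := by
  algebraize [a]
  let g' : B →ₐ[A] κ := { g with commutes' := fun r => RingHom.congr_fun h r }
  let Φ := Algebra.FormallySmooth.liftOfSurjective (AlgHom.id A κ) g' hg hn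
  refine ⟨Φ.toRingHom, ?_, fun y => Φ.commutes y⟩
  intro x
  exact Algebra.FormallySmooth.liftOfSurjective_apply (AlgHom.id A κ) g' hg hn x

theorem formallySmooth_charZero (K L : Type) [Field K] [Field L] [CharZero K] [Algebra K L] :
    Algebra.FormallySmooth K L := by
  obtain ⟨s, hs⟩ := exists_isTranscendenceBasis K L
  have := hs.isAlgebraic_field
  have : CharZero (IntermediateField.adjoin K (Set.range ((↑) : s → L))) := inferInstance
  exact .of_algebraicIndependent_of_isSeparable hs.1

theorem exists_derivation (κ : Type) [Field κ] [Algebra ℂ κ] (t : ℕ)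
    (φ : MvPolynomial (Fin t) ℂ →ₐ[ℂ] κ) (hφ : Function.Injective φ) (u : Fin t → κ) :
    ∃ D : κ → κ, (∀ a b, D (a + b) = D a + D b) ∧ (∀ a b, D (a * b) = a * D b + b * D a) ∧
      (∀ c, D (algebraMap ℂ κ c) = 0) ∧ ∀ l, D (φ (X l)) = u l := by
  let A := MvPolynomial (Fin t) ℂ
  let K := FractionRing A
  let i1 : Algebra A κ := φ.toRingHom.toAlgebra
  have hinj : Function.Injective (algebraMap A κ) := hφ
  have i2 : FaithfulSMul A κ := (faithfulSMul_iff_algebraMap_injective _ _).mpr hinj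
  let i3 : Algebra K κ := FractionRing.liftAlgebra A κ
  have i4 : IsScalarTower A K κ := inferInstance
  have i5 : CharZero A := inferInstance
  have i6 : CharZero K := inferInstance
  have s1 : Algebra.FormallySmooth K κ := formallySmooth_charZero K κ
  have s2 : Algebra.FormallySmooth A K := .of_isLocalization (nonZeroDivisors A)
  have s3 : Algebra.FormallySmooth A κ := .comp A K κ
  let g : TrivSqZeroExt κ κ →+* κ := (TrivSqZeroExt.fstHom ℂ κ κ).toRingHom
  let a : A →ₐ[ℂ] TrivSqZeroExt κ κ := aeval (fun l => TrivSqZeroExt.inl (φ (X l)) + TrivSqZeroExt.inr (u l))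
  have hga : (TrivSqZeroExt.fstHom ℂ κ κ).comp a = φ := by
    apply MvPolynomial.algHom_ext
    intro l
    change (a (X l)).fst = φ (X l)
    have : a (X l) = _ := aeval_X _ l
    rw [this, TrivSqZeroExt.fst_add, TrivSqZeroExt.fst_inl, TrivSqZeroExt.fst_inr, add_zero]
  obtain ⟨Φ, h1, h2⟩ := formallySmooth_lift (A := A) (κ := κ) g
    (fun x => ⟨TrivSqZeroExt.inl x, rfl⟩) ⟨2, by
      rw [pow_two, Ideal.zero_eq_bot, eq_bot_iff, Ideal.mul_le]
      intro r hr s hs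
      have hr' : r.fst = 0 := hr
      have hs' : s.fst = 0 := hs
      rw [Ideal.mem_bot]
      apply TrivSqZeroExt.ext
      · rw [TrivSqZeroExt.fst_mul, hr', zero_mul]; rfl
      · rw [TrivSqZeroExt.snd_mul, hr', hs']
        simp⟩ a.toRingHom (by
        have := congrArg (fun f : A →ₐ[ℂ] κ => f.toRingHom) hga
        exact this)
  have h1' : ∀ x, (Φ x).fst = x := h1
  refine ⟨fun x => (Φ x).snd, ?_, ?_, ?_, ?_⟩
  · intro a b
    change (Φ (a + b)).snd = _
    rw [map_add, TrivSqZeroExt.snd_add]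
  · intro a b
    change (Φ (a * b)).snd = _
    rw [map_mul, TrivSqZeroExt.snd_mul, h1', h1', op_smul_eq_smul]
    rfl
  · intro c
    have h3 := h2 (C c)
    have e1 : algebraMap A κ (C c) = algebraMap ℂ κ c := φ.commutes c
    have e2 : a (C c) = algebraMap ℂ (TrivSqZeroExt κ κ) c := a.commutes c
    rw [e1] at h3
    change (Φ _).snd = 0
    rw [h3]
    change (a (C c)).snd = 0
    rw [e2]
    rfl
  · intro l
    have h3 := h2 (X l)
    have e1 : algebraMap A κ (X l) = φ (X l) := rfl
    rw [e1] at h3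
    change (Φ _).snd = u l
    rw [h3]
    change (a (X l)).snd = u l
    have : a (X l) = _ := aeval_X _ l
    rw [this, TrivSqZeroExt.snd_add, TrivSqZeroExt.snd_inl, TrivSqZeroExt.snd_inr, zero_add]

theorem deriv_chain {σ κ : Type} [Fintype σ] [DecidableEq σ] [Field κ] [Algebra ℂ κ]
    (ψ : MvPolynomial σ ℂ →ₐ[ℂ] κ) (D : κ → κ)
    (hadd : ∀ a b, D (a + b) = D a + D b) (hmul : ∀ a b, D (a * b) = a * D b + b * D a)
    (hC : ∀ c, D (algebraMap ℂ κ c) = 0) (p : MvPolynomial σ ℂ) :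
    D (ψ p) = ∑ j, ψ (pderiv j p) * D (ψ (X j)) := by
  induction p using MvPolynomial.induction_on with
  | C a =>
    have : ψ (C a) = algebraMap ℂ κ a := ψ.commutes a
    rw [this, hC]; simp
  | add p q hp hq =>
    rw [map_add, hadd, hp, hq]
    simp [add_mul, Finset.sum_add_distrib]
  | mul_X p i hp =>
    rw [map_mul, hmul, hp]
    simp only [Derivation.leibniz, pderiv_X, smul_eq_mul, map_add, map_mul, add_mul,
      Finset.sum_add_distrib, Finset.mul_sum]
    congr 1
    · rw [Finset.sum_eq_single i]
      · simp
      · intro b _ hb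
        simp [hb.symm]
      · simp
    · exact Finset.sum_congr rfl fun j _ => by ring



theorem minors_mem_of_param {n t s k : ℕ} (Q : Ideal (MvPolynomial (Fin n ⊕ Fin t) ℂ))
    [Q.IsPrime] (hQ : ∀ p : MvPolynomial (Fin t) ℂ, rename Sum.inr p ∈ Q → p = 0)
    (F : Fin s → MvPolynomial (Fin n ⊕ Fin t) ℂ) (hF : ∀ i, F i ∈ Q)
    (h : ∀ (r : Fin k → Fin s) (c : Fin k → Fin n),
      ((Matrix.of fun i j => pderiv (Sum.inl (c j)) (F (r i)) :
        Matrix (Fin k) (Fin k) (MvPolynomial (Fin n ⊕ Fin t) ℂ))).det ∈ Q)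
    (r : Fin k → Fin s) (c : Fin k → Fin n ⊕ Fin t) :
    ((Matrix.of fun i j => pderiv (c j) (F (r i)) :
        Matrix (Fin k) (Fin k) (MvPolynomial (Fin n ⊕ Fin t) ℂ))).det ∈ Q := by
  obtain ⟨ψ, hψ⟩ : ∃ ψ : MvPolynomial (Fin n ⊕ Fin t) ℂ →ₐ[ℂ]
      FractionRing (MvPolynomial (Fin n ⊕ Fin t) ℂ ⧸ Q), ∀ p, ψ p = 0 ↔ p ∈ Q := by
    refine ⟨(IsScalarTower.toAlgHom ℂ (MvPolynomial (Fin n ⊕ Fin t) ℂ ⧸ Q)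
      (FractionRing (MvPolynomial (Fin n ⊕ Fin t) ℂ ⧸ Q))).comp (Ideal.Quotient.mkₐ ℂ Q), ?_⟩
    intro p
    rw [← Ideal.Quotient.eq_zero_iff_mem]
    exact (FaithfulSMul.algebraMap_eq_zero_iff (MvPolynomial (Fin n ⊕ Fin t) ℂ ⧸ Q)
      (FractionRing (MvPolynomial (Fin n ⊕ Fin t) ℂ ⧸ Q)))
  have hφ : Function.Injective (ψ.comp (rename Sum.inr : MvPolynomial (Fin t) ℂ →ₐ[ℂ] _)) := by
    rw [injective_iff_map_eq_zero]
    intro p hp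
    exact hQ p ((hψ _).mp hp)
  have hD := fun l : Fin t => exists_derivation
    (FractionRing (MvPolynomial (Fin n ⊕ Fin t) ℂ ⧸ Q)) t _ hφ (Pi.single l 1)
  choose D hadd hmul hC hX using hD
  let Jx : Matrix (Fin s) (Fin n) (FractionRing (MvPolynomial (Fin n ⊕ Fin t) ℂ ⧸ Q)) :=
    Matrix.of fun i j => ψ (pderiv (Sum.inl j) (F i))
  let J : Matrix (Fin s) (Fin n ⊕ Fin t) (FractionRing (MvPolynomial (Fin n ⊕ Fin t) ℂ ⧸ Q)) :=
    Matrix.of fun i j => ψ (pderiv j (F i))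
  let W : Matrix (Fin n) (Fin n ⊕ Fin t) (FractionRing (MvPolynomial (Fin n ⊕ Fin t) ℂ ⧸ Q)) :=
    Matrix.of fun j => Sum.elim (fun j' => if j = j' then 1 else 0)
      (fun l => - D l (ψ (X (Sum.inl j))))
  have hJ : J = Jx * W := by
    ext i j
    rw [Matrix.mul_apply]
    cases j with
    | inl j => simp [J, Jx, W]
    | inr l =>
      have h1 := deriv_chain ψ (D l) (hadd l) (hmul l) (hC l) (F i)
      rw [(hψ _).mpr (hF i)] at h1
      have h0 : D l 0 = 0 := by simpa using hC l 0
      have h2 : ∀ m, D l (ψ (X (Sum.inr m))) = (Pi.single l 1 : Fin t → _) m := by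
        intro m
        rw [← hX l m]
        simp
      rw [h0, Fintype.sum_sum_type] at h1
      simp only [h2] at h1
      rw [Finset.sum_eq_single (a := l) (s := (Finset.univ : Finset (Fin t)))] at h1
      · simp only [J, Jx, W, Matrix.of_apply, Sum.elim_inr, mul_neg, Finset.sum_neg_distrib]
        simp only [Pi.single_eq_same, mul_one] at h1
        linear_combination -h1
      · intro b _ hb
        simp [hb]
      · simp
  by_contra hc
  have h3 : k ≤ J.rank := by
    rw [le_rank_iff_minor]
    refine ⟨r, c, ?_⟩
    intro h4
    apply hc
    rw [← hψ, AlgHom.map_det]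
    exact h4
  have h5 : k ≤ Jx.rank := h3.trans (hJ ▸ Matrix.rank_mul_le_left _ _)
  rw [le_rank_iff_minor] at h5
  obtain ⟨r', c', h6⟩ := h5
  apply h6
  have h7 := (hψ _).mpr (h r' c')
  rw [AlgHom.map_det] at h7
  exact h7


theorem exists_param_q {n t s k d : ℕ} (hk : k + d = n)
    (F : Fin s → MvPolynomial (Fin n ⊕ Fin t) ℂ)
    (hrad : (Ideal.span (Set.range F)).IsRadical)
    (p : MvPolynomial (Fin t) ℂ) (hp0 : p ≠ 0)
    (hp : rename Sum.inr p ∈ vIdeal (singLocus (zLocus (Set.range F)) (d + t))) :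
    ∃ q : MvPolynomial (Fin t) ℂ, q ≠ 0 ∧ rename Sum.inr q ∈ Ideal.span (Set.range F ∪
      {g | ∃ (r : Fin k → Fin s) (c : Fin k → Fin n),
        g = (Matrix.of fun i j => pderiv (Sum.inl (c j)) (F (r i)) :
          Matrix (Fin k) (Fin k) (MvPolynomial (Fin n ⊕ Fin t) ℂ)).det}) := by
  rcases exists_prime_or_param (Ideal.span (Set.range F ∪
      {g | ∃ (r : Fin k → Fin s) (c : Fin k → Fin n),
        g = (Matrix.of fun i j => pderiv (Sum.inl (c j)) (F (r i)) :
          Matrix (Fin k) (Fin k) (MvPolynomial (Fin n ⊕ Fin t) ℂ)).det})) with h | h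
  · exact h
  obtain ⟨Q, hQp, hIQ, hQ⟩ := h
  exfalso
  have hF : ∀ i, F i ∈ Q := fun i => hIQ (Ideal.subset_span (Or.inl ⟨i, rfl⟩))
  have hx := fun (r : Fin k → Fin s) (c : Fin k → Fin n) =>
    hIQ (Ideal.subset_span (Or.inr ⟨r, c, rfl⟩))
  have hJ := minors_mem_of_param Q hQ F hF hx
  obtain ⟨S, hS⟩ : ∃ S : Set (MvPolynomial (Fin n ⊕ Fin t) ℂ), S = Set.range F ∪
      {g | ∃ (r : Fin k → Fin s) (c : Fin k → Fin n ⊕ Fin t),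
        g = (Matrix.of fun i j => pderiv (c j) (F (r i)) :
          Matrix (Fin k) (Fin k) (MvPolynomial (Fin n ⊕ Fin t) ℂ)).det} := ⟨_, rfl⟩
  have hSQ : Ideal.span S ≤ Q := by
    rw [Ideal.span_le, hS]
    rintro g (⟨i, rfl⟩ | ⟨r, c, rfl⟩)
    · exact hF i
    · exact hJ r c
  have hsub : zLocus S ⊆ singLocus (zLocus (Set.range F)) (d + t) := by
    intro z hz
    have hz1 : z ∈ zLocus (Set.range F) := fun g hg => hz g (by rw [hS]; exact Or.inl hg)
    refine ⟨hz1, fun hfin => ?_⟩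
    have h1 := finrank_tangentAt F hrad hz1
    rw [hfin, Fintype.card_sum, Fintype.card_fin, Fintype.card_fin] at h1
    have h2 : k ≤ (Matrix.of fun i j => eval z (pderiv j (F i)) :
      Matrix (Fin s) (Fin n ⊕ Fin t) ℂ).rank := by omega
    rw [le_rank_iff_minor] at h2
    obtain ⟨r, c, h3⟩ := h2
    apply h3
    have h4 := hz _ (by rw [hS]; exact Or.inr ⟨r, c, rfl⟩)
    rw [RingHom.map_det] at h4
    exact h4
  have hmem : rename Sum.inr p ∈ vIdeal (zLocus S) := fun z hz => hp z (hsub hz)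
  rw [vIdeal_zLocus_eq] at hmem
  exact hp0 (hQ p ((hQp.radical_le_iff.mpr hSQ) hmem))

theorem eval_specY {n t : ℕ} (η : Fin t → ℂ) (a : Fin n → ℂ)
    (p : MvPolynomial (Fin n ⊕ Fin t) ℂ) :
    eval a (specY η p) = eval (Sum.elim a η) p := by
  unfold specY
  simp only [aeval_eq_bind₁]
  induction p using MvPolynomial.induction_on with
  | C c => simp
  | add p q hp hq => simp [hp, hq]
  | mul_X p i hp => cases i <;> simp [hp]

theorem pderiv_specY {n t : ℕ} (η : Fin t → ℂ) (j : Fin n)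
    (p : MvPolynomial (Fin n ⊕ Fin t) ℂ) :
    pderiv j (specY η p) = specY η (pderiv (Sum.inl j) p) := by
  unfold specY
  simp only [aeval_eq_bind₁]
  induction p using MvPolynomial.induction_on with
  | C c => simp [algebraMap_eq]
  | add p q hp hq => simp [hp, hq]
  | mul_X p i hp =>
    cases i with
    | inl i =>
      by_cases h : i = j
      · subst h; simp [hp, Derivation.leibniz]
      · simp [hp, Derivation.leibniz, pderiv_X_of_ne (R := ℂ) h,
          pderiv_X_of_ne (R := ℂ) (fun h' => h (Sum.inl.inj h') : (Sum.inl i : Fin n ⊕ Fin t) ≠ Sum.inl j)]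
    | inr i =>
      simp [hp, Derivation.leibniz, pderiv_X_of_ne (R := ℂ) (Sum.inr_ne_inl : (Sum.inr i : Fin n ⊕ Fin t) ≠ Sum.inl j)]

theorem fiber_rank {n t s k d : ℕ} (hk : k + d = n)
    (F : Fin s → MvPolynomial (Fin n ⊕ Fin t) ℂ)
    (hrad : (Ideal.span (Set.range F)).IsRadical)
    (p : MvPolynomial (Fin t) ℂ)
    (hp : rename Sum.inr p ∈ vIdeal (singLocus (zLocus (Set.range F)) (d + t)))
    (q : MvPolynomial (Fin t) ℂ) (hq : rename Sum.inr q ∈ Ideal.span (Set.range F ∪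
      {g | ∃ (r : Fin k → Fin s) (c : Fin k → Fin n),
        g = (Matrix.of fun i j => pderiv (Sum.inl (c j)) (F (r i)) :
          Matrix (Fin k) (Fin k) (MvPolynomial (Fin n ⊕ Fin t) ℂ)).det}))
    (η : Fin t → ℂ) (hpη : eval η p ≠ 0) (hqη : eval η q ≠ 0) (a : Fin n → ℂ)
    (ha : ∀ i, eval a (specY η (F i)) = 0) :
    (Matrix.of fun i j => eval a (pderiv j (specY η (F i))) : Matrix (Fin s) (Fin n) ℂ).rank
      = k := by
  have hz : Sum.elim a η ∈ zLocus (Set.range F) := by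
    rintro _ ⟨i, rfl⟩
    rw [← eval_specY]; exact ha i
  have hr : ∀ r : MvPolynomial (Fin t) ℂ, eval (Sum.elim a η) (rename Sum.inr r) = eval η r := by
    intro r
    rw [eval_rename]; rfl
  simp only [pderiv_specY, eval_specY]
  apply le_antisymm
  · have hns : Module.finrank ℂ (tangentAt (zLocus (Set.range F)) (Sum.elim a η)) = d + t := by
      by_contra hne
      exact hpη (by rw [← hr]; exact hp _ ⟨hz, hne⟩)
    have h1 := finrank_tangentAt F hrad hz
    rw [hns, Fintype.card_sum, Fintype.card_fin, Fintype.card_fin] at h1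
    have h2 : (Matrix.of fun i j => eval (Sum.elim a η) (pderiv j (F i)) :
      Matrix (Fin s) (Fin n ⊕ Fin t) ℂ).rank = k := by omega
    rw [← h2]
    exact Matrix.rank_submatrix_le (Matrix.of fun i j => eval (Sum.elim a η) (pderiv j (F i))) id Sum.inl
  · rw [le_rank_iff_minor]
    by_contra hall
    push Not at hall
    apply hqη
    rw [← hr]
    have : Ideal.span (Set.range F ∪
      {g | ∃ (r : Fin k → Fin s) (c : Fin k → Fin n),
        g = (Matrix.of fun i j => pderiv (Sum.inl (c j)) (F (r i)) :
          Matrix (Fin k) (Fin k) (MvPolynomial (Fin n ⊕ Fin t) ℂ)).det}) ≤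
        RingHom.ker (eval (Sum.elim a η)) := by
      rw [Ideal.span_le]
      rintro g (hg | ⟨r, c, rfl⟩)
      · exact hz g hg
      · change eval _ _ = 0
        rw [RingHom.map_det]
        exact hall r c
    exact this hq


theorem height_le_comap_height {A B : Type*} [CommRing A] [CommRing B] (f : A →+* B)
    (hf : Function.Surjective f) (P : Ideal B) [hP : P.IsPrime] :
    P.height ≤ (P.comap f).height := by
  have h1 := PrimeSpectrum.height_eq_orderHeight (⟨P, hP⟩ : PrimeSpectrum B)
  have h2 := PrimeSpectrum.height_eq_orderHeight
    (PrimeSpectrum.comap f (⟨P, hP⟩ : PrimeSpectrum B))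
  change P.height = _ at h1
  change (P.comap f).height = _ at h2
  rw [h1, h2]
  apply Order.height_le_height_apply_of_strictMono
  apply Monotone.strictMono_of_injective
  · intro x y hxy
    exact Ideal.comap_mono hxy
  · exact PrimeSpectrum.comap_injective_of_surjective f hf

theorem height_comap_le_add {B T : Type*} [CommRing B] [CommRing T] [IsNoetherianRing B]
    (π : B →+* T) (hπ : Function.Surjective π) (s : Set B) (hs : RingHom.ker π = Ideal.span s)
    (P : Ideal T) [hP : P.IsPrime] : (P.comap π).height ≤ P.height + s.encard := by
  have hsub : s ⊆ P.comap π := by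
    intro x hx
    have : x ∈ RingHom.ker π := hs ▸ Ideal.subset_span hx
    rw [RingHom.mem_ker] at this
    simp [this]
  have h1 := Ideal.height_le_height_add_encard_of_subset s hsub
  let e : (B ⧸ Ideal.span s) ≃+* T :=
    (Ideal.quotEquivOfEq hs.symm).trans (RingHom.quotientKerEquivOfSurjective hπ)
  have h2 : ((P.comap π).map (Ideal.Quotient.mk (Ideal.span s))).map (e : _ →+* T) = P := by
    rw [Ideal.map_map]
    have : (e : _ →+* T).comp (Ideal.Quotient.mk (Ideal.span s)) = π := by
      ext x; rfl
    rw [this, Ideal.map_comap_of_surjective π hπ]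
  have h3 := RingEquiv.height_map e ((P.comap π).map (Ideal.Quotient.mk (Ideal.span s)))
  have h4 : ((P.comap π).map (Ideal.Quotient.mk (Ideal.span s))).height = P.height := by
    rw [← h3]; exact congrArg Ideal.height h2
  rwa [h4] at h1

theorem le_height_of_equidim {R : Type*} [CommRing R] [Algebra ℂ R] [Algebra.FiniteType ℂ R]
    (I : Ideal R) (D : ℕ) (hI : EquidimIdeal I D) (M : Ideal (R ⧸ I)) [hM : M.IsMaximal] :
    (D : ℕ∞) ≤ M.height := by
  obtain ⟨p0, hp0, hle⟩ := Ideal.exists_minimalPrimes_le (bot_le : (⊥ : Ideal (R ⧸ I)) ≤ M)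
  have hpp : p0.IsPrime := hp0.1.1
  have hmin : p0.comap (Ideal.Quotient.mk I) ∈ I.minimalPrimes := by
    rw [Ideal.minimalPrimes_eq_comap]
    exact ⟨p0, hp0, rfl⟩
  have hdim := hI _ hmin
  have hsurj : Function.Surjective
      ((Ideal.Quotient.mk p0).comp (Ideal.Quotient.mk I)) :=
    Ideal.Quotient.mk_surjective.comp Ideal.Quotient.mk_surjective
  let e : (R ⧸ p0.comap (Ideal.Quotient.mk I)) ≃+* ((R ⧸ I) ⧸ p0) :=
    (Ideal.quotEquivOfEq (by
      rw [← RingHom.comap_ker, Ideal.mk_ker])).trans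
      (RingHom.quotientKerEquivOfSurjective hsurj)
  rw [ringKrullDim_eq_of_ringEquiv e] at hdim
  have hMm : (M.map (Ideal.Quotient.mk p0)).IsMaximal :=
    Ideal.IsMaximal.map_of_surjective_of_ker_le Ideal.Quotient.mk_surjective
      (by rwa [Ideal.mk_ker])
  have h1 := height_maximal_domain ℂ ((R ⧸ I) ⧸ p0) (M.map (Ideal.Quotient.mk p0))
  rw [hdim] at h1
  have h2 := height_le_comap_height (Ideal.Quotient.mk p0) Ideal.Quotient.mk_surjective
    (M.map (Ideal.Quotient.mk p0))
  rw [Ideal.comap_map_of_surjective _ Ideal.Quotient.mk_surjective, ← RingHom.ker_eq_comap_bot,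
    Ideal.mk_ker, sup_eq_left.mpr hle] at h2
  have h3 : (M.map (Ideal.Quotient.mk p0)).height = (D : ℕ∞) := by
    exact WithBot.coe_injective h1
  rwa [h3] at h2

theorem sub_rename_specY_mem {n t : ℕ} (η : Fin t → ℂ) (r : MvPolynomial (Fin n ⊕ Fin t) ℂ) :
    r - rename Sum.inl (specY η r) ∈ Ideal.span (Set.range fun l : Fin t =>
      (X (Sum.inr l) - C (η l) : MvPolynomial (Fin n ⊕ Fin t) ℂ)) := by
  unfold specY
  simp only [aeval_eq_bind₁]
  induction r using MvPolynomial.induction_on with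
  | C c => simp
  | add p q hp hq =>
    have := Ideal.add_mem _ hp hq
    simp only [map_add]
    convert this using 1; ring
  | mul_X p i hp =>
    cases i with
    | inl i =>
      have := Ideal.mul_mem_right (X (Sum.inl i)) _ hp
      simp only [map_mul, bind₁_X_right, Sum.elim_inl, rename_X]
      convert this using 1; ring
    | inr i =>
      have h1 := Ideal.mul_mem_right (C (η i)) _ hp
      have h2 := Ideal.mul_mem_left (Ideal.span (Set.range fun l : Fin t =>
        (X (Sum.inr l) - C (η l) : MvPolynomial (Fin n ⊕ Fin t) ℂ))) p
          (Ideal.subset_span ⟨i, rfl⟩)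
      have := Ideal.add_mem _ h1 h2
      simp only [map_mul, bind₁_X_right, Sum.elim_inr, rename_C]
      convert this using 1; ring

theorem fiber_height {n t s d : ℕ} (F : Fin s → MvPolynomial (Fin n ⊕ Fin t) ℂ)
    (hF : EquidimIdeal (Ideal.span (Set.range F)) (d + t)) (η : Fin t → ℂ)
    (M : Ideal (MvPolynomial (Fin n) ℂ ⧸ Ideal.span (Set.range fun i => specY η (F i))))
    [hM : M.IsMaximal] : (d : ℕ∞) ≤ M.height := by
  obtain ⟨φ, hph⟩ : ∃ φ : MvPolynomial (Fin n ⊕ Fin t) ℂ →+* MvPolynomial (Fin n) ℂ,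
      ∀ p, φ p = specY η p := ⟨(aeval (Sum.elim X (fun l => C (η l)))).toRingHom, fun _ => rfl⟩
  have hle : Ideal.span (Set.range F) ≤
      RingHom.ker ((Ideal.Quotient.mk (Ideal.span (Set.range fun i => specY η (F i)))).comp φ) := by
    rw [Ideal.span_le]
    rintro _ ⟨i, rfl⟩
    change _ = _
    rw [RingHom.comp_apply, hph, Ideal.Quotient.eq_zero_iff_mem]
    exact Ideal.subset_span ⟨i, rfl⟩
  have hspec : ∀ q : MvPolynomial (Fin n) ℂ, specY (t := t) η (rename Sum.inl q) = q := by
    intro q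
    unfold specY
    rw [aeval_rename]
    exact aeval_X_left_apply q
  obtain ⟨π, hπmk⟩ : ∃ π : (MvPolynomial (Fin n ⊕ Fin t) ℂ ⧸ Ideal.span (Set.range F)) →+*
      (MvPolynomial (Fin n) ℂ ⧸ Ideal.span (Set.range fun i => specY η (F i))),
      ∀ r, π (Ideal.Quotient.mk _ r) = Ideal.Quotient.mk _ (specY η r) :=
    ⟨Ideal.Quotient.lift (Ideal.span (Set.range F)) _ (fun a ha => hle ha), fun r => by
      rw [← hph]; rfl⟩
  have hπ : Function.Surjective π := by
    intro y
    obtain ⟨q, rfl⟩ := Ideal.Quotient.mk_surjective y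
    refine ⟨Ideal.Quotient.mk _ (rename Sum.inl q), ?_⟩
    rw [hπmk, hspec]
  obtain ⟨S, hS⟩ : ∃ S : Set (MvPolynomial (Fin n ⊕ Fin t) ℂ ⧸ Ideal.span (Set.range F)),
    S = Set.range fun l : Fin t => Ideal.Quotient.mk (Ideal.span (Set.range F))
      (X (Sum.inr l) - C (η l)) := ⟨_, rfl⟩
  have hmk : ∀ r ∈ Ideal.span (Set.range fun l : Fin t =>
      (X (Sum.inr l) - C (η l) : MvPolynomial (Fin n ⊕ Fin t) ℂ)),
      Ideal.Quotient.mk (Ideal.span (Set.range F)) r ∈ Ideal.span S := by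
    intro r hr
    have := Ideal.mem_map_of_mem (Ideal.Quotient.mk (Ideal.span (Set.range F))) hr
    rw [Ideal.map_span, ← Set.range_comp] at this
    rw [hS]; exact this
  have hker : RingHom.ker π = Ideal.span S := by
    apply le_antisymm
    · intro y hy
      obtain ⟨r, rfl⟩ := Ideal.Quotient.mk_surjective y
      have h1 : specY η r ∈ Ideal.span (Set.range fun i => specY η (F i)) := by
        rw [← Ideal.Quotient.eq_zero_iff_mem, ← hπmk]
        exact hy
      have h2 : Ideal.span (Set.range fun i => specY η (F i)) ≤ (Ideal.span S).comap
          ((Ideal.Quotient.mk (Ideal.span (Set.range F))).comp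
            (rename (R := ℂ) (Sum.inl : Fin n → Fin n ⊕ Fin t)).toRingHom) := by
        rw [Ideal.span_le]
        rintro _ ⟨i, rfl⟩
        have h3 := hmk _ (sub_rename_specY_mem η (F i))
        rw [map_sub, (Ideal.Quotient.eq_zero_iff_mem (a := F i)).mpr (Ideal.subset_span (Set.mem_range_self i)),
          zero_sub, neg_mem_iff] at h3
        exact h3
      have h4 := h2 h1
      have h5 := Ideal.add_mem _ (hmk _ (sub_rename_specY_mem η r)) h4
      rw [map_sub] at h5
      convert h5 using 1
      exact (sub_add_cancel _ _).symm
    · rw [Ideal.span_le, hS]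
      rintro _ ⟨l, rfl⟩
      change π _ = 0
      have h0 : specY (n := n) η (X (Sum.inr l) - C (η l)) = 0 := by
        simp [specY, algebraMap_eq]
      rw [hπmk, h0, map_zero]
  have h1 := height_comap_le_add π hπ S hker M
  have hMB : (M.comap π).IsMaximal := Ideal.comap_isMaximal_of_surjective π hπ
  have h2 := le_height_of_equidim _ (d + t) hF (M.comap π)
  have h3 : S.encard ≤ t := by
    have h5 := Set.encard_image_le (fun l : Fin t => Ideal.Quotient.mk (Ideal.span (Set.range F))
      (X (Sum.inr l) - C (η l))) Set.univ
    rw [Set.image_univ, ← hS] at h5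
    simpa using h5
  have h4 : ((d + t : ℕ) : ℕ∞) ≤ M.height + t := h2.trans (h1.trans (by gcongr))
  rw [Nat.cast_add] at h4
  exact (ENat.add_le_add_iff_right (ENat.natCast_ne_top t)).mp h4


/-- The linear form centred at `a` with coefficients `v`. -/
def linAt {n : ℕ} (a : Fin n → ℂ) : (Fin n → ℂ) →ₗ[ℂ] MvPolynomial (Fin n) ℂ where
  toFun v := ∑ l, C (v l) * (X l - C (a l))
  map_add' v w := by simp [add_mul, Finset.sum_add_distrib]
  map_smul' c v := by simp [Finset.mul_sum, mul_assoc, MvPolynomial.smul_eq_C_mul]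

theorem linAt_mem {n : ℕ} (a : Fin n → ℂ) (v : Fin n → ℂ) :
    linAt a v ∈ RingHom.ker (eval a) := by
  rw [RingHom.mem_ker]
  simp [linAt]

theorem linAt_single {n : ℕ} (a : Fin n → ℂ) (i : Fin n) :
    linAt a (Pi.single i 1) = X i - C (a i) := by
  change ∑ l, C ((Pi.single i 1 : Fin n → ℂ) l) * (X l - C (a l)) = _
  rw [Finset.sum_eq_single i]
  · simp
  · intro b _ hb
    simp [hb]
  · simp

theorem taylor_mem {n : ℕ} (a : Fin n → ℂ) (p : MvPolynomial (Fin n) ℂ) :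
    p - C (eval a p) - linAt a (fun l => eval a (pderiv l p)) ∈
      RingHom.ker (eval a) * RingHom.ker (eval a) := by
  induction p using MvPolynomial.induction_on with
  | C c =>
    have : (fun l : Fin n => eval a (pderiv l (C c))) = 0 := by ext l; simp
    rw [this, map_zero]
    simp
  | add p q hp hq =>
    have : (fun l : Fin n => eval a (pderiv l (p + q))) =
      (fun l : Fin n => eval a (pderiv l p)) + (fun l : Fin n => eval a (pderiv l q)) := by
      ext l; simp
    rw [this, map_add]
    convert Ideal.add_mem _ hp hq using 1
    simp only [map_add]
    ring
  | mul_X p i hp =>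
    have : (fun l : Fin n => eval a (pderiv l (p * X i))) =
      a i • (fun l : Fin n => eval a (pderiv l p)) + (eval a p) • (Pi.single i 1) := by
      ext l
      by_cases h : i = l
      · subst h; simp [Derivation.leibniz]; ring
      · simp [Derivation.leibniz, pderiv_X_of_ne (R := ℂ) h, Ne.symm h]
    rw [this, map_add, map_smul, map_smul, linAt_single]
    have h1 := Ideal.mul_mem_right (X i) _ hp
    have h2 : linAt a (fun l => eval a (pderiv l p)) * (X i - C (a i)) ∈
        RingHom.ker (eval a) * RingHom.ker (eval a) :=
      Ideal.mul_mem_mul (linAt_mem _ _) (by rw [RingHom.mem_ker]; simp)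
    convert Ideal.add_mem _ h1 h2 using 1
    simp only [map_mul, eval_X, MvPolynomial.smul_eq_C_mul]
    ring

theorem exists_complement_rows {n s k d : ℕ} (hk : k + d = n) (M : Matrix (Fin s) (Fin n) ℂ)
    (hM : M.rank = k) : ∃ v : Fin d → (Fin n → ℂ),
      Submodule.span ℂ (Set.range M.row) ⊔ Submodule.span ℂ (Set.range v) = ⊤ := by
  obtain ⟨U, hU⟩ := Submodule.exists_isCompl (Submodule.span ℂ (Set.range M.row))
  have h1 := Submodule.finrank_add_eq_of_isCompl hU
  rw [← Matrix.rank_eq_finrank_span_row, hM, Module.finrank_fin_fun] at h1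
  have h2 : Module.finrank ℂ U = d := by omega
  let b := Module.finBasisOfFinrankEq ℂ U h2
  refine ⟨fun i => (b i : Fin n → ℂ), ?_⟩
  have h3 : Submodule.span ℂ (Set.range fun i => (b i : Fin n → ℂ)) = U := by
    have := congrArg (Submodule.map U.subtype) b.span_eq
    rw [Submodule.map_span, ← Set.range_comp, Submodule.map_top, Submodule.range_subtype] at this
    exact this
  rw [h3]
  exact hU.sup_eq_top

theorem ker_eval_le {n : ℕ} (a : Fin n → ℂ) (J : Ideal (MvPolynomial (Fin n) ℂ))
    (hJ : RingHom.ker (eval a) * RingHom.ker (eval a) ≤ J) (h : ∀ v, linAt a v ∈ J) :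
    RingHom.ker (eval a) ≤ J := by
  intro p hp
  have h1 := hJ (taylor_mem a p)
  rw [RingHom.mem_ker] at hp
  rw [hp, map_zero, sub_zero] at h1
  have := Ideal.add_mem _ h1 (h (fun l => eval a (pderiv l p)))
  rwa [sub_add_cancel] at this

theorem exists_linear_params {n s k d : ℕ} (hk : k + d = n) (g : Fin s → MvPolynomial (Fin n) ℂ)
    (a : Fin n → ℂ) (ha : ∀ i, eval a (g i) = 0)
    (hr : (Matrix.of fun i j => eval a (pderiv j (g i)) : Matrix (Fin s) (Fin n) ℂ).rank = k) :
    ∃ ℓ : Fin d → MvPolynomial (Fin n) ℂ, (∀ i, ℓ i ∈ RingHom.ker (eval a)) ∧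
      RingHom.ker (eval a) ≤ Ideal.span (Set.range g) ⊔ Ideal.span (Set.range ℓ) ⊔
        RingHom.ker (eval a) * RingHom.ker (eval a) := by
  obtain ⟨v, hv⟩ := exists_complement_rows hk _ hr
  refine ⟨fun i => linAt a (v i), fun i => linAt_mem a _, ?_⟩
  apply ker_eval_le _ _ le_sup_right
  obtain ⟨J, hJ⟩ : ∃ J, J = Ideal.span (Set.range g) ⊔
      Ideal.span (Set.range fun i => linAt a (v i)) ⊔
        RingHom.ker (eval a) * RingHom.ker (eval a) := ⟨_, rfl⟩
  rw [← hJ]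
  have h1 : (⊤ : Submodule ℂ (Fin n → ℂ)) ≤ (J.restrictScalars ℂ).comap (linAt a) := by
    rw [← hv, sup_le_iff, Submodule.span_le, Submodule.span_le]
    constructor
    · rintro _ ⟨i, rfl⟩
      change linAt a (fun l => eval a (pderiv l (g i))) ∈ J
      have h2 := taylor_mem a (g i)
      rw [ha i, map_zero, sub_zero] at h2
      have h3 : g i ∈ J := hJ ▸ (Ideal.mem_sup_left (Ideal.mem_sup_left
        (Ideal.subset_span ⟨i, rfl⟩)))
      have h4 : g i - linAt a (fun l => eval a (pderiv l (g i))) ∈ J :=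
        hJ ▸ (Ideal.mem_sup_right h2)
      have := Ideal.sub_mem _ h3 h4
      rwa [sub_sub_cancel] at this
    · rintro _ ⟨i, rfl⟩
      change linAt a (v i) ∈ J
      exact hJ ▸ (Ideal.mem_sup_left (Ideal.mem_sup_right (Ideal.subset_span ⟨i, rfl⟩)))
  intro w
  exact h1 (Submodule.mem_top : w ∈ ⊤)

theorem maximalIdeal_eq_span {P S : Type*} [CommRing P] [CommRing S] [IsLocalRing S]
    [IsNoetherianRing S] (ρ : P →+* S) (m G : Ideal P) (hm : m.map ρ = IsLocalRing.maximalIdeal S)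
    (hG : G.map ρ = ⊥) {d : ℕ} (ℓ : Fin d → P) (hl : ∀ i, ℓ i ∈ m)
    (hle : m ≤ G ⊔ Ideal.span (Set.range ℓ) ⊔ m * m) :
    Ideal.span (Set.range fun i => ρ (ℓ i)) = IsLocalRing.maximalIdeal S := by
  apply le_antisymm
  · rw [Ideal.span_le]
    rintro _ ⟨i, rfl⟩
    rw [← hm]
    exact Ideal.mem_map_of_mem ρ (hl i)
  · apply Submodule.le_of_le_smul_of_le_jacobson_bot (I := IsLocalRing.maximalIdeal S)
      (IsNoetherian.noetherian _) (IsLocalRing.maximalIdeal_le_jacobson _)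
    have := Ideal.map_mono (f := ρ) hle
    rw [Ideal.map_sup, Ideal.map_sup, Ideal.map_mul, hG, bot_sup_eq, hm, Ideal.map_span,
      ← Set.range_comp] at this
    exact this

theorem fiber_local {n s k d : ℕ} (hk : k + d = n) (g : Fin s → MvPolynomial (Fin n) ℂ)
    (hr : ∀ a, (∀ i, eval a (g i) = 0) →
      (Matrix.of fun i j => eval a (pderiv j (g i)) : Matrix (Fin s) (Fin n) ℂ).rank = k)
    (M : Ideal (MvPolynomial (Fin n) ℂ ⧸ Ideal.span (Set.range g))) [hM : M.IsMaximal]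
    (hd : (d : ℕ∞) ≤ M.height) :
    IsDomain (Localization.AtPrime M) ∧ M.height = d := by
  have hmax : (M.comap (Ideal.Quotient.mk (Ideal.span (Set.range g)))).IsMaximal :=
    Ideal.comap_isMaximal_of_surjective _ Ideal.Quotient.mk_surjective
  obtain ⟨a, ha⟩ := MvPolynomial.isMaximal_iff_eq_vanishingIdeal_singleton.mp hmax
  have ha' : M.comap (Ideal.Quotient.mk (Ideal.span (Set.range g))) = RingHom.ker (eval a) := by
    rw [ha]
    ext p
    rw [mem_vanishingIdeal_iff, RingHom.mem_ker]
    simp [aeval_eq_eval]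
  have hz : ∀ i, eval a (g i) = 0 := by
    intro i
    rw [← RingHom.mem_ker, ← ha', Ideal.mem_comap,
      (Ideal.Quotient.eq_zero_iff_mem (a := g i)).mpr (Ideal.subset_span (Set.mem_range_self i))]
    exact M.zero_mem
  obtain ⟨ℓ, hl, hle⟩ := exists_linear_params hk g a hz (hr a hz)
  let ρ := (algebraMap (MvPolynomial (Fin n) ℂ ⧸ Ideal.span (Set.range g))
    (Localization.AtPrime M)).comp (Ideal.Quotient.mk (Ideal.span (Set.range g)))
  have hm : (RingHom.ker (eval a)).map ρ = IsLocalRing.maximalIdeal (Localization.AtPrime M) := by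
    rw [← Ideal.map_map, ← ha', Ideal.map_comap_of_surjective _ Ideal.Quotient.mk_surjective]
    exact Localization.AtPrime.map_eq_maximalIdeal
  have hG : (Ideal.span (Set.range g)).map ρ = ⊥ := by
    rw [← Ideal.map_map, Ideal.map_quotient_self, Ideal.map_bot]
  have : IsNoetherianRing (Localization.AtPrime M) :=
    IsLocalization.isNoetherianRing M.primeCompl _ inferInstance
  have hspan := maximalIdeal_eq_span (P := MvPolynomial (Fin n) ℂ) (S := Localization.AtPrime M) ρ
    (RingHom.ker (eval a)) (Ideal.span (Set.range g)) hm hG ℓ hl hle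
  have hdim : ringKrullDim (Localization.AtPrime M) = (M.height : WithBot ℕ∞) :=
    IsLocalization.AtPrime.ringKrullDim_eq_height M (Localization.AtPrime M)
  constructor
  · refine isDomain_of_regular d (Localization.AtPrime M) ?_ _ hspan
    rw [hdim]
    exact WithBot.coe_le_coe.mpr hd
  · apply le_antisymm _ hd
    have h1 := ringKrullDim_le_spanFinrank_maximalIdeal (R := Localization.AtPrime M)
    rw [hdim, ← hspan] at h1
    have h2 : (Submodule.spanFinrank (Ideal.span (Set.range fun i => ρ (ℓ i)))) ≤ d := by
      have h3 := Submodule.spanFinrank_span_le_ncard_of_finite (R := Localization.AtPrime M)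
        (Set.finite_range fun i => ρ (ℓ i))
      refine h3.trans ?_
      have h5 := Set.ncard_image_le (f := fun i => ρ (ℓ i)) (Set.finite_univ (α := Fin d))
      rw [Set.image_univ] at h5
      simpa [Set.ncard_univ] using h5
    have h4 : (M.height : WithBot ℕ∞) ≤ ((d : ℕ∞) : WithBot ℕ∞) :=
      h1.trans (by exact_mod_cast h2)
    exact WithBot.coe_le_coe.mp h4


theorem dim_quot_comap {R : Type*} [CommRing R] (I : Ideal R) (P0 : Ideal (R ⧸ I)) :
    ringKrullDim (R ⧸ P0.comap (Ideal.Quotient.mk I)) = ringKrullDim ((R ⧸ I) ⧸ P0) := by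
  have hsurj : Function.Surjective ((Ideal.Quotient.mk P0).comp (Ideal.Quotient.mk I)) :=
    Ideal.Quotient.mk_surjective.comp Ideal.Quotient.mk_surjective
  let e : (R ⧸ P0.comap (Ideal.Quotient.mk I)) ≃+* ((R ⧸ I) ⧸ P0) :=
    (Ideal.quotEquivOfEq (by
      rw [← RingHom.comap_ker, Ideal.mk_ker])).trans
      (RingHom.quotientKerEquivOfSurjective hsurj)
  exact ringKrullDim_eq_of_ringEquiv e

theorem fiber_good {n s k d : ℕ} (hk : k + d = n) (g : Fin s → MvPolynomial (Fin n) ℂ)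
    (hr : ∀ a, (∀ i, eval a (g i) = 0) →
      (Matrix.of fun i j => eval a (pderiv j (g i)) : Matrix (Fin s) (Fin n) ℂ).rank = k)
    (hd : ∀ (M : Ideal (MvPolynomial (Fin n) ℂ ⧸ Ideal.span (Set.range g))) [M.IsMaximal],
      (d : ℕ∞) ≤ M.height) : GoodSpec g d := by
  have hloc := fun (M : Ideal (MvPolynomial (Fin n) ℂ ⧸ Ideal.span (Set.range g)))
    (hM : M.IsMaximal) => fiber_local hk g hr M (hd M)
  have hred : IsReduced (MvPolynomial (Fin n) ℂ ⧸ Ideal.span (Set.range g)) := by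
    apply isReduced_ofLocalizationMaximal
    intro M hM
    have := (hloc M hM).1
    infer_instance
  have hrad : (Ideal.span (Set.range g)).IsRadical :=
    (Ideal.isRadical_iff_quotient_reduced _).mpr hred
  refine ⟨hrad, Or.inr ⟨?_, ?_⟩⟩
  · intro P hP
    have hPp : P.IsPrime := hP.1.1
    obtain ⟨P0, hP0, rfl⟩ : P ∈ Ideal.comap (Ideal.Quotient.mk (Ideal.span (Set.range g))) ''
        minimalPrimes (MvPolynomial (Fin n) ℂ ⧸ Ideal.span (Set.range g)) := by
      rw [← Ideal.minimalPrimes_eq_comap]; exact hP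
    have hP0p : P0.IsPrime := hP0.1.1
    rw [dim_quot_comap]
    obtain ⟨M, hM, hPM⟩ := Ideal.exists_le_maximal P0 hP0p.ne_top
    obtain ⟨hdom, hht⟩ := hloc M hM
    apply le_antisymm
    · refine (ringKrullDim_quotient_le P0).trans ?_
      refine (ringKrullDim_le_iff_isMaximal_height_le (d : WithBot ℕ∞)).mpr ?_
      intro M' hM'
      rw [(hloc M' hM').2]
      exact le_rfl
    · have hdim : ringKrullDim (Localization.AtPrime M) = (M.height : WithBot ℕ∞) :=
        IsLocalization.AtPrime.ringKrullDim_eq_height M (Localization.AtPrime M)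
      have hkp : (RingHom.ker (algebraMap (MvPolynomial (Fin n) ℂ ⧸ Ideal.span (Set.range g))
          (Localization.AtPrime M))).IsPrime := RingHom.ker_isPrime _
      have hker : RingHom.ker (algebraMap (MvPolynomial (Fin n) ℂ ⧸ Ideal.span (Set.range g))
          (Localization.AtPrime M)) ≤ P0 := by
        intro x hx
        rw [RingHom.mem_ker, IsLocalization.map_eq_zero_iff M.primeCompl] at hx
        obtain ⟨c, hc⟩ := hx
        have : (c : MvPolynomial (Fin n) ℂ ⧸ Ideal.span (Set.range g)) * x ∈ P0 := by
          rw [hc]; exact P0.zero_mem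
        exact (hP0p.mem_or_mem this).resolve_left fun h => c.2 (hPM h)
      have hkeq : P0 ≤ RingHom.ker (algebraMap (MvPolynomial (Fin n) ℂ ⧸ Ideal.span (Set.range g))
          (Localization.AtPrime M)) := hP0.2 ⟨hkp, bot_le⟩ hker
      have h1 : ringKrullDim (Localization.AtPrime M) ≤
          ringKrullDim ((MvPolynomial (Fin n) ℂ ⧸ Ideal.span (Set.range g)) ⧸ P0) := by
        rw [ringKrullDim_quotient]
        refine Order.krullDim_le_of_strictMono
          (fun q => ⟨PrimeSpectrum.comap (algebraMap _ _) q, ?_⟩) ?_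
        · intro x hx
          have := hkeq hx
          rw [RingHom.mem_ker] at this
          change algebraMap _ (Localization.AtPrime M) x ∈ q.asIdeal
          rw [this]
          exact q.asIdeal.zero_mem
        · intro q q' hqq
          change PrimeSpectrum.comap _ q < PrimeSpectrum.comap _ q'
          have hmono : Monotone (PrimeSpectrum.comap (algebraMap (MvPolynomial (Fin n) ℂ ⧸
            Ideal.span (Set.range g)) (Localization.AtPrime M))) :=
              fun _ _ h => Ideal.comap_mono h
          exact hmono.strictMono_of_injective
            (PrimeSpectrum.localization_comap_injective _ M.primeCompl) hqq
      rw [hdim, hht] at h1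
      exact h1
  · ext a
    simp only [Set.mem_empty_iff_false, iff_false]
    rintro ⟨ha, hne⟩
    have h1 := finrank_tangentAt g hrad ha
    rw [hr a (fun i => ha _ ⟨i, rfl⟩), Fintype.card_fin] at h1
    omega

theorem main_aux {n t s d : ℕ} (f : Fin s → MvPolynomial (Fin n ⊕ Fin t) ℚ)
    (hA : AssumpA f d) :
    ∃ ℬ : Set (Fin t → ℂ), IsZariskiOpen ℬ ∧ ℬ.Nonempty ∧
      ∀ η ∈ ℬ, GoodSpec (fun i => specY η (toC (f i))) d := by
  obtain ⟨hrad, hne, heq, hsing⟩ := hA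
  have hradC := radical_toC f hrad
  have hvI : vIdeal (VC f) = Ideal.span (Set.range fun i => toC (f i)) := by
    unfold VC
    rw [vIdeal_zLocus_eq, hradC.radical]
  rw [hvI] at heq
  have hdn : d ≤ n := by
    obtain ⟨z, hz⟩ := hne
    have hle : Ideal.span (Set.range fun i => toC (f i)) ≤ RingHom.ker (eval z) := by
      rw [Ideal.span_le]
      intro p hp
      exact hz p hp
    have hkp : (RingHom.ker (eval z)).IsPrime := RingHom.ker_isPrime (eval z)
    obtain ⟨P, hP, -⟩ := Ideal.exists_minimalPrimes_le
      (J := RingHom.ker (eval z)) hle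
    have h1 := heq P hP
    have h2 := ringKrullDim_quotient_le P
    rw [h1, MvPolynomial.ringKrullDim_of_isNoetherianRing, ringKrullDim_eq_zero_of_field] at h2
    simp only [Nat.card_eq_fintype_card, Fintype.card_sum, Fintype.card_fin, zero_add] at h2
    have h2' : (((d + t : ℕ) : ℕ∞) : WithBot ℕ∞) ≤ (((n + t : ℕ) : ℕ∞) : WithBot ℕ∞) := h2
    have h3 : d + t ≤ n + t := Nat.cast_le.mp (WithBot.coe_le_coe.mp h2')
    omega
  obtain ⟨k, hk⟩ : ∃ k, k + d = n := ⟨n - d, by omega⟩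
  obtain ⟨p, hp0, hp⟩ := exists_param_of_setDim_lt _ hsing
  obtain ⟨q, hq0, hq⟩ := exists_param_q hk (fun i => toC (f i)) hradC p hp0 hp
  refine ⟨{η | eval η (p * q) ≠ 0}, ⟨{p * q}, by simp⟩, ?_, ?_⟩
  · by_contra hemp
    apply mul_ne_zero hp0 hq0
    apply MvPolynomial.funext
    intro η
    by_contra h
    exact hemp ⟨η, by simpa using h⟩
  · intro η hη
    have hη' : eval η p * eval η q ≠ 0 := by
      rw [← map_mul]; exact hη
    apply fiber_good hk
    · intro a ha
      exact fiber_rank hk _ hradC p hp q hq η (left_ne_zero_of_mul hη')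
        (right_ne_zero_of_mul hη') a ha
    · intro M hM
      exact fiber_height (fun i => toC (f i)) heq η M


/-- Lemma B-param: under Assumptions A and B, there is a nonempty
Zariski open `ℬ ⊆ ℂ^t` of parameters over which the specialized system generates a
radical equidimensional ideal whose zero set is empty or smooth of dimension `d`. -/
theorem statement_4 (n t s d : ℕ) (f : Fin s → MvPolynomial (Fin n ⊕ Fin t) ℚ)
    (hA : AssumpA f d) (hB : AssumpB f) :
    ∃ ℬ : Set (Fin t → ℂ), IsZariskiOpen ℬ ∧ ℬ.Nonempty ∧
      ∀ η ∈ ℬ, GoodSpec (fun i => specY η (toC (f i))) d := by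
  exact main_aux f hA

end
end

section
/- Let f = (f_1,…,f_s) ⊂ ℚ[y][x] with x = (x_1,…,x_n), y = (y_1,…,y_t), satisfy Assumptions A and B, and let 𝒲 be the set of points of V at which the Jacobian matrix jac_x(f) of f with respect to the variables x has rank at most n−d−1. Then the Zariski closure of π(𝒲) is a proper Zariski closed subset of ℂ^t; in particular π(𝒲) is contained in a proper Zariski closed subset of ℂ^t. -/
open MvPolynomial

noncomputable section

open Cardinal in
lemma aux_ext (F K L : Type) [CommRing F] [IsDomain F] [Field K] [Field L] [IsAlgClosed K] [IsAlgClosed L]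
    [Algebra F K] [Algebra F L] [FaithfulSMul F K] [FaithfulSMul F L] (hF : #F ≤ ℵ₀)
    (hK : ℵ₀ < #K) (hKL : #K = #L) : Nonempty (K →ₐ[F] L) := by
  obtain ⟨s, hs⟩ := exists_isTranscendenceBasis F K
  obtain ⟨t, ht⟩ := exists_isTranscendenceBasis F L
  have h1 := IsAlgClosed.cardinal_eq_cardinal_transcendence_basis_of_aleph0_lt' _ hs hF hK
  have h2 := IsAlgClosed.cardinal_eq_cardinal_transcendence_basis_of_aleph0_lt' _ ht hF (hKL ▸ hK)
  have h3 : #s = #t := by rw [← h1, ← h2, hKL]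
  obtain ⟨e⟩ := Cardinal.eq.1 h3
  let B := Algebra.adjoin F (Set.range ((↑) : s → K))
  have : Algebra.IsAlgebraic B K := hs.isAlgebraic
  have hw : AlgebraicIndependent F (fun i : s => ((e i : t) : L)) := ht.1.comp e e.injective
  let φ : B →ₐ[F] L := (aeval (fun i : s => ((e i : t) : L))).comp hs.1.aevalEquiv.symm.toAlgHom
  have hφ : Function.Injective φ := by
    intro a b h
    exact hs.1.aevalEquiv.symm.injective (hw h)
  let : Algebra B L := φ.toRingHom.toAlgebra
  have : IsScalarTower F B L := IsScalarTower.of_algebraMap_eq (fun x => (φ.commutes x).symm)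
  have : Module.IsTorsionFree B L := by
    rw [Module.isTorsionFree_iff_algebraMap_injective]
    exact hφ
  exact ⟨(IsAlgClosed.lift (R := B) (S := K) (M := L)).restrictScalars F⟩

open Cardinal in
lemma aux_ext' (F : Type) [CommRing F] [IsDomain F] (hF : #F ≤ ℵ₀) (i j : F →+* ℂ)
    (hi : Function.Injective i) (hj : Function.Injective j) :
    ∃ σ : ℂ →+* ℂ, ∀ x, σ (i x) = j x := by
  have key := @aux_ext F ℂ ℂ _ _ _ _ _ _ i.toAlgebra j.toAlgebra
    (by let := i.toAlgebra; exact (faithfulSMul_iff_algebraMap_injective F ℂ).2 hi)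
    (by let := j.toAlgebra; exact (faithfulSMul_iff_algebraMap_injective F ℂ).2 hj)
    hF (by rw [Cardinal.mk_complex]; exact Cardinal.aleph0_lt_continuum) rfl
  obtain ⟨f⟩ := key
  exact ⟨@AlgHom.toRingHom F ℂ ℂ _ _ _ i.toAlgebra j.toAlgebra f,
    fun x => @AlgHom.commutes F ℂ ℂ _ _ _ i.toAlgebra j.toAlgebra f x⟩

lemma aux_move (a : ℂ) (ha : a ∉ Set.range (algebraMap ℚ ℂ)) : ∃ σ : ℂ →+* ℂ, σ a ≠ a := by
  by_cases hal : IsAlgebraic ℚ a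
  · have hint := hal.isIntegral
    have hirr := minpoly.irreducible hint
    obtain ⟨b, hb, hba⟩ : ∃ b : ℂ, Polynomial.aeval b (minpoly ℚ a) = (0:ℂ) ∧ b ≠ a := by
      by_contra! hcon
      have hcard := Polynomial.card_rootSet_eq_natDegree (K := ℂ) hirr.separable
        (IsAlgClosed.splits _)
      have hle : Fintype.card ((minpoly ℚ a).rootSet ℂ) ≤ 1 := by
        rw [Fintype.card_le_one_iff]
        rintro ⟨u, hu⟩ ⟨v, hv⟩
        rw [Subtype.mk.injEq, hcon u (Polynomial.aeval_eq_zero_of_mem_rootSet hu),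
          hcon v (Polynomial.aeval_eq_zero_of_mem_rootSet hv)]
      have hpos := minpoly.natDegree_pos hint
      exact ha (minpoly.natDegree_eq_one_iff.1 (by omega))
    have : Fact (Irreducible (minpoly ℚ a)) := ⟨hirr⟩
    obtain ⟨σ, hσ⟩ := aux_ext' (AdjoinRoot (minpoly ℚ a))
      ((Cardinal.mk_le_of_surjective AdjoinRoot.mk_surjective).trans (by simp))
      (AdjoinRoot.lift (algebraMap ℚ ℂ) a (minpoly.aeval ℚ a))
      (AdjoinRoot.lift (algebraMap ℚ ℂ) b hb) (RingHom.injective _) (RingHom.injective _)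
    refine ⟨σ, ?_⟩
    have h3 : σ a = b := by
      have h := hσ (AdjoinRoot.root _)
      have h1 := AdjoinRoot.lift_root (i := algebraMap ℚ ℂ) (a := a) (f := minpoly ℚ a)
        (minpoly.aeval ℚ a)
      have h2 := AdjoinRoot.lift_root (i := algebraMap ℚ ℂ) (a := b) (f := minpoly ℚ a) hb
      exact (congrArg σ h1).symm.trans (h.trans h2)
    rw [h3]; exact hba
  · have hinj : Function.Injective (Polynomial.aeval (R := ℚ) a) :=
      transcendental_iff_injective.1 hal
    have hinj' : Function.Injective (Polynomial.aeval (R := ℚ) (a+1)) := by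
      apply transcendental_iff_injective.1
      intro h
      apply hal
      simpa using h.sub (isAlgebraic_one (R := ℚ) (A := ℂ))
    obtain ⟨σ, hσ⟩ := aux_ext' (Polynomial ℚ) (by
      simp) (Polynomial.aeval a).toRingHom
      (Polynomial.aeval (a+1)).toRingHom hinj hinj'
    refine ⟨σ, ?_⟩
    have := hσ Polynomial.X
    simp at this
    rw [this]; simp

open TensorProduct in
lemma aux_red (A : Type) [CommRing A] [Algebra ℚ A] [IsReduced A] : IsReduced (ℂ ⊗[ℚ] A) := by
  classical
  let b := Module.Free.chooseBasis ℚ A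
  let B := Algebra.TensorProduct.basis ℂ b
  constructor
  by_contra! hcon
  -- minimal support
  obtain ⟨x, ⟨hxn, hx0⟩, hmin⟩ := exists_minimalFor_of_wellFoundedLT
    (fun x : ℂ ⊗[ℚ] A => IsNilpotent x ∧ x ≠ 0) (fun x => (B.repr x).support.card) hcon
  obtain ⟨i, hi⟩ : ∃ i, B.repr x i ≠ 0 := by
    by_contra! h
    exact hx0 (B.repr.injective (by ext i; simp [h i]))
  set c := B.repr x i
  let y := c⁻¹ • x
  have hyn : IsNilpotent y := by
    obtain ⟨m, hm⟩ := hxn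
    exact ⟨m, by simp [y, smul_pow, hm]⟩
  have hy1 : B.repr y i = 1 := by simp [y, c, hi]
  have hysupp : (B.repr y).support ⊆ (B.repr x).support := by
    simpa [y] using Finsupp.support_smul
  have hfix : ∀ (σ : ℂ →+* ℂ) j, σ (B.repr y j) = B.repr y j := by
    intro σ j
    let τ : ℂ →ₐ[ℚ] ℂ := σ.toRatAlgHom
    let T := Algebra.TensorProduct.map τ (AlgHom.id ℚ A)
    have hT : ∀ z j, B.repr (T z) j = σ (B.repr z j) := by
      intro z j
      induction z using TensorProduct.induction_on with
      | zero => simp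
      | tmul u v => simp [T, B, τ]
      | add u v hu hv => simp [hu, hv]
    by_contra hne
    have hz0 : T y - y ≠ 0 := by
      intro h
      apply hne
      rw [← hT, sub_eq_zero.1 h]
    have hzn : IsNilpotent (T y - y) :=
      (Commute.all _ _).isNilpotent_sub (hyn.map T) hyn
    have hlt : (B.repr (T y - y)).support ⊂ (B.repr x).support := by
      refine (Finset.ssubset_iff_of_subset ?_).2 ⟨i, by simpa using hi, by simp [hT, hy1]⟩
      intro k hk
      apply hysupp
      simp only [Finsupp.mem_support_iff, map_sub, Finsupp.sub_apply, hT] at hk ⊢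
      intro h0
      simp [h0] at hk
    have h1 := Finset.card_lt_card hlt
    have h2 := hmin ⟨hzn, hz0⟩ h1.le
    exact absurd h1 (not_lt.2 h2)
  have hrat : ∀ j, ∃ q : ℚ, algebraMap ℚ ℂ q = B.repr y j := by
    intro j
    by_contra h
    obtain ⟨σ, hσ⟩ := aux_move (B.repr y j) (by simpa using h)
    exact hσ (hfix σ j)
  choose q hq using hrat
  let w : A := ∑ j ∈ (B.repr y).support, q j • b j
  have hyw : y = Algebra.TensorProduct.includeRight (R := ℚ) (A := ℂ) w := by
    rw [← B.linearCombination_repr y, Finsupp.linearCombination_apply, Finsupp.sum, map_sum]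
    refine Finset.sum_congr rfl fun j _ => ?_
    rw [← hq j]
    simp [B]
    rw [TensorProduct.smul_tmul']
    simp [Algebra.smul_def]
  have hwn : IsNilpotent w := by
    rw [hyw] at hyn
    exact (IsNilpotent.map_iff (Algebra.TensorProduct.includeRight_injective
      (RingHom.injective _))).1 hyn
  have hw0 : w = 0 := hwn.eq_zero
  rw [hyw, hw0] at hy1
  simp at hy1

lemma aux_nil {A B : Type} [CommRing A] [CommRing B] [IsReduced B] (J : Ideal A) (φ : A →+* B)
    (θ : B →+* A ⧸ J) (hφ : ∀ p ∈ J, φ p = 0) (hθ : ∀ p, θ (φ p) = Ideal.Quotient.mk J p) :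
    J.IsRadical := by
  rintro p ⟨m, hm⟩
  have h : φ p = 0 := IsNilpotent.eq_zero ⟨m, by rw [← map_pow, hφ _ hm]⟩
  rw [← Ideal.Quotient.eq_zero_iff_mem, ← hθ, h, map_zero]

open TensorProduct in
set_option maxHeartbeats 2000000 in
lemma aux_radical {σ : Type} (f : Set (MvPolynomial σ ℚ)) (hf : (Ideal.span f).IsRadical) :
    (Ideal.span (MvPolynomial.map (algebraMap ℚ ℂ) '' f)).IsRadical := by
  set I := Ideal.span f
  set J := Ideal.span (MvPolynomial.map (algebraMap ℚ ℂ) '' f) with hJ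
  have : IsReduced (MvPolynomial σ ℚ ⧸ I) := (Ideal.isRadical_iff_quotient_reduced I).1 hf
  have hred := aux_red (MvPolynomial σ ℚ ⧸ I)
  let ψ : MvPolynomial σ ℂ →ₐ[ℂ] ℂ ⊗[ℚ] (MvPolynomial σ ℚ ⧸ I) :=
    aeval (fun i => (1:ℂ) ⊗ₜ[ℚ] (Ideal.Quotient.mk I (X i)))
  have hψ : ∀ p : MvPolynomial σ ℚ, ψ (MvPolynomial.map (algebraMap ℚ ℂ) p) =
      (1:ℂ) ⊗ₜ[ℚ] (Ideal.Quotient.mk I p) := by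
    intro p
    induction p using MvPolynomial.induction_on with
    | C q =>
      simp only [MvPolynomial.map_C, ψ, MvPolynomial.aeval_C]
      rw [Algebra.TensorProduct.algebraMap_apply]
      have : (Ideal.Quotient.mk I) (C q) = q • (1 : MvPolynomial σ ℚ ⧸ I) := by
        rw [← Algebra.algebraMap_eq_smul_one]; rfl
      rw [this, ← TensorProduct.smul_tmul]
      simp [Algebra.smul_def]
    | add p q hp hq => simp [hp, hq, TensorProduct.tmul_add]
    | mul_X p i hp =>
      simp only [map_mul, hp, MvPolynomial.map_X]
      simp [ψ]
  have hψJ : ∀ p ∈ J, ψ p = 0 := by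
    intro p hp
    have : J ≤ RingHom.ker ψ := by
      rw [hJ, Ideal.span_le]
      rintro _ ⟨g, hg, rfl⟩
      have : Ideal.Quotient.mk I g = 0 :=
        Ideal.Quotient.eq_zero_iff_mem.2 (Ideal.subset_span hg)
      simp [hψ, this]
    exact this hp
  let θ0 : (MvPolynomial σ ℚ ⧸ I) →ₐ[ℚ] (MvPolynomial σ ℂ ⧸ J) :=
    Ideal.Quotient.liftₐ I ((Ideal.Quotient.mkₐ ℚ J).comp
      (MvPolynomial.mapAlgHom (Algebra.ofId ℚ ℂ))) (by
        intro a ha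
        have : I ≤ RingHom.ker ((Ideal.Quotient.mkₐ ℚ J).comp
            (MvPolynomial.mapAlgHom (σ := σ) (Algebra.ofId ℚ ℂ))) := by
          rw [Ideal.span_le]
          intro g hg
          exact Ideal.Quotient.eq_zero_iff_mem.2 (Ideal.subset_span ⟨g, hg, rfl⟩)
        exact this ha)
  let θ : ℂ ⊗[ℚ] (MvPolynomial σ ℚ ⧸ I) →ₐ[ℂ] (MvPolynomial σ ℂ ⧸ J) :=
    Algebra.TensorProduct.lift (Algebra.ofId ℂ _) θ0 (fun _ _ => Commute.all _ _)
  have hθψ : θ.comp ψ = Ideal.Quotient.mkₐ ℂ J := by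
    ext i
    have h0 : θ0 (Ideal.Quotient.mk I (X i)) = Ideal.Quotient.mk J (X i) := by
      show Ideal.Quotient.mk J (MvPolynomial.map _ (X i)) = _
      rw [MvPolynomial.map_X]
    simp [ψ, θ, h0]
  have hh : ∀ p, θ (ψ p) = Ideal.Quotient.mk J p := fun p => congrArg (fun F => F p) hθψ
  exact aux_nil (B := ℂ ⊗[ℚ] (MvPolynomial σ ℚ ⧸ I)) J ψ.toRingHom θ.toRingHom hψJ hh

lemma aux_dim_integral {R S : Type*} [CommRing R] [CommRing S] [Algebra R S]
    [Algebra.IsIntegral R S] [FaithfulSMul R S] : ringKrullDim R ≤ ringKrullDim S := by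
  rw [ringKrullDim, Order.krullDim]
  refine iSup_le fun l => ?_
  obtain ⟨Q, hQ⟩ := Ideal.nonempty_primesOver (S := S) l.head.asIdeal
  have := hQ.1
  have := hQ.2
  obtain ⟨L, hL, -⟩ := Ideal.exists_ltSeries_of_hasGoingUp l Q
  rw [← hL]
  exact Order.LTSeries.length_le_krullDim L

lemma aux_dim {A : Type} [CommRing A] [IsDomain A] [Algebra ℂ A] [Algebra.FiniteType ℂ A] (t : ℕ)
    (y : Fin t → A) (hy : AlgebraicIndependent ℂ y) : (t : WithBot (WithTop ℕ)) ≤ ringKrullDim A := by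
  obtain ⟨s, g, hg, hint⟩ := exists_integral_inj_algHom_of_fg ℂ A
  let : Algebra (MvPolynomial (Fin s) ℂ) A := g.toRingHom.toAlgebra
  have : IsScalarTower ℂ (MvPolynomial (Fin s) ℂ) A :=
    IsScalarTower.of_algebraMap_eq fun x => (g.commutes x).symm
  have : Algebra.IsIntegral (MvPolynomial (Fin s) ℂ) A := ⟨hint⟩
  have : FaithfulSMul (MvPolynomial (Fin s) ℂ) A :=
    (faithfulSMul_iff_algebraMap_injective _ _).2 hg
  have h1 := aux_dim_integral (R := MvPolynomial (Fin s) ℂ) (S := A)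
  rw [MvPolynomial.ringKrullDim_of_isNoetherianRing, ringKrullDim_eq_zero_of_field] at h1
  have h2 := hy.lift_cardinalMk_le_trdeg
  have h3 : Algebra.trdeg ℂ A = s := by
    have := trdeg_add_eq ℂ (MvPolynomial (Fin s) ℂ) (A := A)
    rw [← this, MvPolynomial.trdeg_of_isDomain, _root_.trdeg_eq_zero]
    simp
  rw [h3] at h2
  simp at h2
  refine le_trans ?_ h1
  simp
  exact Nat.cast_le.2 h2

/-- Dual numbers, without the standard algebra structures. -/
def DualAux (K : Type) : Type := TrivSqZeroExt K K

instance (K : Type) [Field K] : CommRing (DualAux K) :=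
  inferInstanceAs (CommRing (TrivSqZeroExt K K))

lemma aux_taylor {σ K : Type} [Fintype σ] [Field K] [Algebra ℂ K] (z δ : σ → K)
    (f : MvPolynomial σ ℂ) :
    aeval (R := ℂ) (fun i => (TrivSqZeroExt.inl (z i) + TrivSqZeroExt.inr (δ i) : TrivSqZeroExt K K)) f
      = TrivSqZeroExt.inl (aeval z f) +
        TrivSqZeroExt.inr (∑ i, aeval z (pderiv i f) * δ i) := by
  classical
  induction f using MvPolynomial.induction_on with
  | C a =>
    apply TrivSqZeroExt.ext
    · simp [-DualNumber.inr_eq_smul_eps, TrivSqZeroExt.algebraMap_eq_inl']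
    · simp [-DualNumber.inr_eq_smul_eps, TrivSqZeroExt.algebraMap_eq_inl']
  | add p q hp hq =>
    rw [map_add, hp, hq]
    apply TrivSqZeroExt.ext
    · simp [-DualNumber.inr_eq_smul_eps]
    · simp [-DualNumber.inr_eq_smul_eps, add_mul, Finset.sum_add_distrib]
  | mul_X p i hp =>
    rw [map_mul, hp, aeval_X]
    apply TrivSqZeroExt.ext
    · simp [-DualNumber.inr_eq_smul_eps]
    · have h : ∀ j, aeval z (pderiv j (p * X i)) * δ j =
          z i * (aeval z (pderiv j p) * δ j) + aeval z p * (if i = j then δ j else 0) := by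
        intro j
        rw [pderiv_mul, pderiv_X, Pi.single_apply]
        by_cases hij : i = j
        · subst hij
          simp
          ring
        · simp [hij]
          ring
      simp only [h, Finset.sum_add_distrib, ← Finset.mul_sum, Finset.sum_ite_eq, Finset.mem_univ,
        if_true]
      simp [-DualNumber.inr_eq_smul_eps]
      ring

lemma aux_sq {K : Type} [Field K] (a b : TrivSqZeroExt K K) (ha : a.fst = 0) (hb : b.fst = 0) :
    a * b = 0 := by
  refine TrivSqZeroExt.ext ?_ ?_
  · rw [TrivSqZeroExt.fst_mul, ha, zero_mul]; rfl
  · rw [TrivSqZeroExt.snd_mul, ha, hb]; simp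

lemma aux_smooth_lift {L K : Type} [Field L] [CharZero L] [Field K] [Algebra L K]
    [Algebra.EssFiniteType L K] (φ : L →+* TrivSqZeroExt K K)
    (hφ : ∀ x, (φ x).fst = algebraMap L K x) :
    ∃ ψ : K →+* TrivSqZeroExt K K, (∀ x, (ψ x).fst = x) ∧ ∀ x, ψ (algebraMap L K x) = φ x := by
  let B := DualAux K
  let φ' : L →+* B := φ
  let : Algebra L B := φ'.toAlgebra
  let π : B →ₐ[L] K := { (TrivSqZeroExt.fstHom K K K).toRingHom with commutes' := hφ }
  have hπ : Function.Surjective π := fun x => ⟨(TrivSqZeroExt.inl x : TrivSqZeroExt K K), rfl⟩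
  let I : Ideal B := RingHom.ker π
  have hI : I ^ 2 = ⊥ := by
    rw [eq_bot_iff, pow_two, Ideal.mul_le]
    intro a ha b hb
    have ha' : (TrivSqZeroExt.fst (a : TrivSqZeroExt K K)) = 0 := ha
    have hb' : (TrivSqZeroExt.fst (b : TrivSqZeroExt K K)) = 0 := hb
    show (a : TrivSqZeroExt K K) * b = 0
    exact aux_sq a b ha' hb'
  let e : (B ⧸ I) ≃ₐ[L] K := Ideal.quotientKerAlgEquivOfSurjective hπ
  obtain ⟨ψ, hψ⟩ := Algebra.FormallySmooth.exists_lift (R := L) (A := K) I ⟨2, hI⟩ e.symm.toAlgHom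
  refine ⟨ψ.toRingHom, ?_, fun x => ψ.commutes x⟩
  intro x
  have h1 := congrArg (fun F => e (F x)) hψ
  simp at h1
  exact h1

lemma aux_deriv {K : Type} [Field K] [Algebra ℂ K] [Algebra.EssFiniteType ℂ K] {t : ℕ}
    (y : Fin t → K) (hy : AlgebraicIndependent ℂ y) (δ : Fin t → K) :
    ∃ ψ : K →+* TrivSqZeroExt K K, (∀ x, (ψ x).fst = x) ∧
      (∀ c : ℂ, ψ (algebraMap ℂ K c) = algebraMap ℂ _ c) ∧
      ∀ j, ψ (y j) = TrivSqZeroExt.inl (y j) + TrivSqZeroExt.inr (δ j) := by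
  let S := MvPolynomial (Fin t) ℂ
  let L := FractionRing S
  let ι : L →ₐ[ℂ] K := IsFractionRing.liftAlgHom (g := (aeval y : S →ₐ[ℂ] K)) hy
  let : Algebra L K := ι.toRingHom.toAlgebra
  have : IsScalarTower ℂ L K := IsScalarTower.of_algebraMap_eq fun x => (ι.commutes x).symm
  have : Algebra.EssFiniteType L K := Algebra.EssFiniteType.of_comp ℂ L K
  have : CharZero L := charZero_of_injective_algebraMap (algebraMap ℂ L).injective
  let φ0 : S →ₐ[ℂ] TrivSqZeroExt K K :=
    aeval (fun j => TrivSqZeroExt.inl (y j) + TrivSqZeroExt.inr (δ j))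
  have hφ0 : ∀ p, (φ0 p).fst = aeval y p := by
    intro p
    simp only [φ0]
    rw [aux_taylor, TrivSqZeroExt.fst_add, TrivSqZeroExt.fst_inl, TrivSqZeroExt.fst_inr, add_zero]
  let φ : L →+* TrivSqZeroExt K K := IsLocalization.lift (M := nonZeroDivisors S) (g := φ0.toRingHom) (by
    rintro ⟨p, hp⟩
    have hp0 := nonZeroDivisors.ne_zero hp
    apply TrivSqZeroExt.isUnit_iff_isUnit_fst.2
    have : aeval y p ≠ 0 := fun h => hp0 (hy (by simpa using h))
    simpa [hφ0] using this)
  have hφS : ∀ p : S, φ (algebraMap S L p) = φ0 p := fun p => IsLocalization.lift_eq _ p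
  have hιS : ∀ p : S, algebraMap L K (algebraMap S L p) = aeval y p :=
    fun p => IsFractionRing.lift_algebraMap hy p
  have hφ : ∀ x, (φ x).fst = algebraMap L K x := by
    have : ((TrivSqZeroExt.fstHom K K K).toRingHom.comp φ) = algebraMap L K := by
      apply IsLocalization.ringHom_ext (nonZeroDivisors S)
      refine RingHom.ext fun p => ?_
      show (φ (algebraMap S L p)).fst = algebraMap L K (algebraMap S L p)
      rw [hφS, hφ0, hιS]
    intro x
    exact congrArg (fun F => F x) this
  obtain ⟨ψ, h1, h2⟩ := aux_smooth_lift φ hφ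
  refine ⟨ψ, h1, ?_, ?_⟩
  · intro c
    have := h2 (algebraMap S L (C c))
    rw [hιS, hφS, aeval_C] at this
    exact this.trans (aeval_C _ _)
  · intro j
    have := h2 (algebraMap S L (X j))
    rw [hιS, hφS, aeval_X] at this
    exact this.trans (aeval_X _ _)

lemma aux_rows {K : Type} [Field K] {m n : Type} [Fintype m] [Fintype n] (M : Matrix m n K) (k : ℕ)
    (h : k ≤ M.rank) : ∃ r : Fin k → m, LinearIndependent K (M.submatrix r id).row := by
  classical
  obtain ⟨κ, a, ha, hs, hl⟩ := exists_linearIndependent' K M.row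
  have : Finite κ := Finite.of_injective a ha
  have := Fintype.ofFinite κ
  have hc : Fintype.card κ = M.rank := by
    rw [Matrix.rank_eq_finrank_span_row, ← hs, finrank_span_eq_card hl]
  have e : Nonempty (Fin k ↪ κ) := by
    apply Function.Embedding.nonempty_of_card_le
    simpa [hc] using h
  obtain ⟨e⟩ := e
  exact ⟨a ∘ e, hl.comp e e.injective⟩

lemma aux_minor {K : Type} [Field K] {m n : Type} [Fintype m] [Fintype n] (M : Matrix m n K) (k : ℕ)
    (h : k ≤ M.rank) : ∃ (r : Fin k → m) (c : Fin k → n), (M.submatrix r c).det ≠ 0 := by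
  obtain ⟨r, hr⟩ := aux_rows M k h
  have h1 := hr.rank_matrix
  obtain ⟨c, hc⟩ := aux_rows (M.submatrix r id).transpose k (by
    rw [Matrix.rank_transpose, h1]; simp)
  refine ⟨r, c, ?_⟩
  rw [Matrix.linearIndependent_rows_iff_isUnit, Matrix.isUnit_iff_isUnit_det] at hc
  have := hc.ne_zero
  rw [← Matrix.det_transpose]
  exact this

lemma aux_minor' {K : Type} [Field K] {m n : Type} [Fintype m] [Fintype n] (M : Matrix m n K) (k : ℕ)
    (r : Fin k → m) (c : Fin k → n) (h : (M.submatrix r c).det ≠ 0) : k ≤ M.rank := by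
  have h1 := Matrix.rank_of_det_ne_zero h
  have h2 := Matrix.rank_submatrix_le M r c
  rw [h1] at h2
  simpa using h2


lemma aux_rank_le {n t s : ℕ} {K : Type} [Field K] [Algebra ℂ K] [Algebra.EssFiniteType ℂ K]
    (F : Fin s → MvPolynomial (Fin n ⊕ Fin t) ℂ) (z : Fin n ⊕ Fin t → K)
    (hz : ∀ i, aeval z (F i) = 0) (hy : AlgebraicIndependent ℂ (fun l => z (Sum.inr l))) :
    (Matrix.of fun i j => aeval z (pderiv j (F i)) : Matrix (Fin s) (Fin n ⊕ Fin t) K).rank ≤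
    (Matrix.of fun i j => aeval z (pderiv (Sum.inl j) (F i)) : Matrix (Fin s) (Fin n) K).rank := by
  classical
  have key : ∀ l : Fin t, ∃ D : Fin n → K, ∀ i,
      ∑ j, aeval z (pderiv (Sum.inl j) (F i)) * D j + aeval z (pderiv (Sum.inr l) (F i)) = 0 := by
    intro l
    obtain ⟨ψ, h1, h2, h3⟩ := aux_deriv _ hy (Pi.single l 1)
    refine ⟨fun j => (ψ (z (Sum.inl j))).snd, fun i => ?_⟩
    let ψ' : K →ₐ[ℂ] TrivSqZeroExt K K := { ψ with commutes' := h2 }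
    have hcomp : ψ'.comp (aeval z) = aeval (R := ℂ)
        (fun i => (TrivSqZeroExt.inl (z i) + TrivSqZeroExt.inr ((ψ (z i)).snd) :
          TrivSqZeroExt K K)) := by
      apply MvPolynomial.algHom_ext
      intro k
      rw [AlgHom.comp_apply, aeval_X, aeval_X]
      show ψ (z k) = _
      conv_rhs => rw [← h1 (z k)]
      rw [h1]
      refine TrivSqZeroExt.ext ?_ ?_
      · rw [TrivSqZeroExt.fst_add, TrivSqZeroExt.fst_inl, TrivSqZeroExt.fst_inr, add_zero, h1]
      · rw [TrivSqZeroExt.snd_add, TrivSqZeroExt.snd_inl, TrivSqZeroExt.snd_inr, zero_add]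
    have h4 : ψ' (aeval z (F i)) = _ := congrArg (fun G => G (F i)) hcomp
    rw [hz i, map_zero] at h4
    have h5 := congrArg TrivSqZeroExt.snd (h4.trans (aux_taylor _ _ _))
    rw [TrivSqZeroExt.snd_add, TrivSqZeroExt.snd_inl, TrivSqZeroExt.snd_inr, zero_add,
      Fintype.sum_sum_type, TrivSqZeroExt.snd_zero] at h5
    have h6 : ∀ m, (ψ (z (Sum.inr m))).snd = (Pi.single l 1 : Fin t → K) m := by
      intro m
      rw [h3, TrivSqZeroExt.snd_add, TrivSqZeroExt.snd_inl, TrivSqZeroExt.snd_inr, zero_add]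
    simp only [h6, Pi.single_apply, mul_ite, mul_one, mul_zero, Finset.sum_ite_eq',
      Finset.mem_univ, if_true] at h5
    exact h5.symm
  choose D hD using key
  let M : Matrix (Fin n) (Fin n ⊕ Fin t) K :=
    Matrix.of fun j => Sum.elim (fun j' => if j = j' then 1 else 0) (fun l => - D l j)
  have hM : (Matrix.of fun i j => aeval z (pderiv j (F i)) : Matrix (Fin s) (Fin n ⊕ Fin t) K) =
      (Matrix.of fun i j => aeval z (pderiv (Sum.inl j) (F i)) : Matrix (Fin s) (Fin n) K) * M := by
    ext i j
    rw [Matrix.mul_apply]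
    cases j with
    | inl j => simp [M]
    | inr l =>
      simp only [M, Matrix.of_apply, Sum.elim_inr, mul_neg, Finset.sum_neg_distrib]
      linear_combination hD l i
  rw [hM]
  exact Matrix.rank_mul_le_left _ _

lemma aux_vIdeal {σ : Type} [Finite σ] (S : Set (MvPolynomial σ ℂ)) (hS : (Ideal.span S).IsRadical) :
    vIdeal (zLocus S) = Ideal.span S := by
  have h := MvPolynomial.vanishingIdeal_zeroLocus_eq_radical (k := ℂ) (K := ℂ) (Ideal.span S)
  rw [hS.radical, MvPolynomial.zeroLocus_span] at h
  rw [← h]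
  rfl

/-- points where the full Jacobian drops rank are singular -/
lemma aux_sing {σ : Type} [Fintype σ] [DecidableEq σ] {s : ℕ} (F : Fin s → MvPolynomial σ ℂ)
    (hF : (Ideal.span (Set.range F)).IsRadical) (e : ℕ) (z : σ → ℂ)
    (hz : z ∈ zLocus (Set.range F))
    (hr : (Matrix.of fun i j => eval z (pderiv j (F i)) : Matrix (Fin s) σ ℂ).rank + e
      < Fintype.card σ) : z ∈ singLocus (zLocus (Set.range F)) e := by
  refine ⟨hz, ?_⟩
  set M := (Matrix.of fun i j => eval z (pderiv j (F i)) : Matrix (Fin s) σ ℂ) with hM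
  have hle : LinearMap.ker M.mulVecLin ≤ tangentAt (zLocus (Set.range F)) z := by
    intro v hv g hg
    rw [aux_vIdeal _ hF] at hg
    have hv' : ∀ i, polyDiff z (F i) v = 0 := by
      intro i
      have h := congrFun (LinearMap.mem_ker.1 hv) i
      simp only [Matrix.mulVecLin_apply, Matrix.mulVec, dotProduct, hM, Matrix.of_apply,
        Pi.zero_apply] at h
      rw [← h, polyDiff]
      exact Finset.sum_congr rfl fun _ _ => mul_comm _ _
    have : eval z g = 0 ∧ polyDiff z g v = 0 := by
      induction hg using Submodule.span_induction with
      | mem x hx =>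
        obtain ⟨i, rfl⟩ := hx
        exact ⟨hz _ ⟨i, rfl⟩, hv' i⟩
      | zero => simp [polyDiff]
      | add x y _ _ hx hy =>
        refine ⟨by simp [hx.1, hy.1], ?_⟩
        have h1 := hx.2
        have h2 := hy.2
        simp only [polyDiff] at h1 h2 ⊢
        simp only [map_add, mul_add, Finset.sum_add_distrib, h1, h2, add_zero]
      | smul a x _ hx =>
        refine ⟨by simp [hx.1], ?_⟩
        have h1 := hx.2
        simp only [polyDiff] at h1 ⊢
        have : ∀ j, v j * eval z (pderiv j (a • x)) = eval z a * (v j * eval z (pderiv j x)) := by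
          intro j
          rw [smul_eq_mul, pderiv_mul, map_add, map_mul, map_mul, hx.1]
          ring
        simp only [this, ← Finset.mul_sum, h1, mul_zero]
    exact this.2
  have h1 := Submodule.finrank_mono hle
  have h2 := LinearMap.finrank_range_add_finrank_ker M.mulVecLin
  rw [Module.finrank_fintype_fun_eq_card] at h2
  rw [Matrix.rank] at hr
  omega


lemma aux_prime {n t s : ℕ} (F : Fin s → MvPolynomial (Fin n ⊕ Fin t) ℂ) (k : ℕ)
    (W : Set (Fin n ⊕ Fin t → ℂ))
    (hW : ∀ z ∈ W, z ∈ zLocus (Set.range F) ∧ (jacXAt F z).rank < k)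
    (hd : ∀ p : MvPolynomial (Fin t) ℂ, p ≠ 0 → ∃ z ∈ W, eval (projYC z) p ≠ 0) :
    ∃ P : Ideal (MvPolynomial (Fin n ⊕ Fin t) ℂ), P.IsPrime ∧ (∀ i, F i ∈ P) ∧
      (∀ (r : Fin k → Fin s) (c : Fin k → Fin n),
        ((Matrix.of fun i j => pderiv (Sum.inl j) (F i) :
          Matrix (Fin s) (Fin n) (MvPolynomial (Fin n ⊕ Fin t) ℂ)).submatrix r c).det ∈ P) ∧
      AlgebraicIndependent ℂ (fun l : Fin t => Ideal.Quotient.mk P (X (Sum.inr l))) := by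
  let S : Submonoid (MvPolynomial (Fin n ⊕ Fin t) ℂ) :=
    (nonZeroDivisors (MvPolynomial (Fin t) ℂ)).map
      (rename Sum.inr : MvPolynomial (Fin t) ℂ →ₐ[ℂ] MvPolynomial (Fin n ⊕ Fin t) ℂ)
  have hdisj : Disjoint ((vIdeal W : Ideal _) : Set (MvPolynomial (Fin n ⊕ Fin t) ℂ)) S := by
    rw [Set.disjoint_left]
    rintro _ h1 ⟨p, hp, rfl⟩
    obtain ⟨z, hz, hz'⟩ := hd p (nonZeroDivisors.ne_zero hp)
    apply hz'
    have h := h1 z hz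
    erw [eval_rename] at h
    exact h
  obtain ⟨P, hP, hle, hPS⟩ := Ideal.exists_le_prime_disjoint (vIdeal W) S hdisj
  refine ⟨P, hP, fun i => hle fun z hz => (hW z hz).1 _ ⟨i, rfl⟩, fun r c => hle fun z hz => ?_, ?_⟩
  · by_contra hne
    refine absurd (hW z hz).2 (not_lt.2 (aux_minor' _ k r c ?_))
    rw [RingHom.map_det] at hne
    exact hne
  · rw [algebraicIndependent_iff]
    intro p hp
    by_contra hp0
    have h : aeval (fun l : Fin t => Ideal.Quotient.mk P (X (Sum.inr l))) p
        = Ideal.Quotient.mk P (rename Sum.inr p) := by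
      have hh : (aeval (fun l : Fin t => Ideal.Quotient.mk P (X (Sum.inr l)))) =
          (Ideal.Quotient.mkₐ ℂ P).comp (rename Sum.inr) := by
        apply MvPolynomial.algHom_ext
        intro l
        rw [aeval_X, AlgHom.comp_apply, rename_X]
        rfl
      rw [hh]
      rfl
    rw [h, Ideal.Quotient.eq_zero_iff_mem] at hp
    exact Set.disjoint_left.1 hPS hp ⟨p, mem_nonZeroDivisors_of_ne_zero hp0, rfl⟩

lemma aux_minors {n t s : ℕ} (F : Fin s → MvPolynomial (Fin n ⊕ Fin t) ℂ) (k : ℕ)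
    (P : Ideal (MvPolynomial (Fin n ⊕ Fin t) ℂ)) [hP : P.IsPrime] (hFP : ∀ i, F i ∈ P)
    (hm : ∀ (r : Fin k → Fin s) (c : Fin k → Fin n),
        ((Matrix.of fun i j => pderiv (Sum.inl j) (F i) :
          Matrix (Fin s) (Fin n) (MvPolynomial (Fin n ⊕ Fin t) ℂ)).submatrix r c).det ∈ P)
    (hy : AlgebraicIndependent ℂ (fun l : Fin t => Ideal.Quotient.mk P (X (Sum.inr l))))
    (r : Fin k → Fin s) (c : Fin k → Fin n ⊕ Fin t) :
    ((Matrix.of fun i j => pderiv j (F i) :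
          Matrix (Fin s) (Fin n ⊕ Fin t) (MvPolynomial (Fin n ⊕ Fin t) ℂ)).submatrix r c).det ∈ P := by
  let A := MvPolynomial (Fin n ⊕ Fin t) ℂ ⧸ P
  let K := FractionRing A
  have : Algebra.EssFiniteType ℂ K := by
    have : Algebra.EssFiniteType A K := Algebra.EssFiniteType.of_isLocalization K (nonZeroDivisors A)
    exact Algebra.EssFiniteType.comp ℂ A K
  let φ : MvPolynomial (Fin n ⊕ Fin t) ℂ →ₐ[ℂ] K :=
    (IsScalarTower.toAlgHom ℂ A K).comp (Ideal.Quotient.mkₐ ℂ P)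
  let z : Fin n ⊕ Fin t → K := fun i => φ (X i)
  have hφ : ∀ p, aeval z p = φ p := fun p => congrArg (fun G => G p) (aeval_unique φ).symm
  have hφP : ∀ p, φ p = 0 ↔ p ∈ P := by
    intro p
    rw [← Ideal.Quotient.eq_zero_iff_mem]
    exact (IsFractionRing.injective A K).eq_iff' (map_zero _)
  have hy' : AlgebraicIndependent ℂ (fun l => z (Sum.inr l)) :=
    hy.map' (f := IsScalarTower.toAlgHom ℂ A K) (IsFractionRing.injective A K)
  have hr := aux_rank_le F z (fun i => by rw [hφ, hφP]; exact hFP i) hy'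
  simp only [hφ] at hr
  by_contra hne
  rw [← hφP, AlgHom.map_det] at hne
  have h1 := aux_minor' (Matrix.of fun i j => φ (pderiv j (F i)) :
    Matrix (Fin s) (Fin n ⊕ Fin t) K) k r c hne
  obtain ⟨r', c', h2⟩ := aux_minor _ k (h1.trans hr)
  apply h2
  have h3 := (hφP _).2 (hm r' c')
  rw [AlgHom.map_det] at h3
  exact h3

/-- under Assumptions A and B, the projection of the locus `𝒲` where the
Jacobian with respect to `x` has rank at most `n-d-1` is contained in a proper Zariski
closed subset of `ℂ^t`. -/
theorem statement_5 (n t s d : ℕ) (f : Fin s → MvPolynomial (Fin n ⊕ Fin t) ℚ)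
    (hA : AssumpA f d) (hB : AssumpB f) :
    ∀ W : Set ((Fin n ⊕ Fin t) → ℂ),
      W = {z | z ∈ VC f ∧ (jacXAt (fun i => toC (f i)) z).rank + d + 1 ≤ n} →
      ∃ p : MvPolynomial (Fin t) ℂ, p ≠ 0 ∧ ∀ z ∈ W, eval (projYC z) p = 0 := by
  rintro W rfl
  by_cases hdn : n ≤ d
  · exact ⟨1, one_ne_zero, fun z hz => absurd hz.2 (by omega)⟩
  by_contra! hcon
  obtain ⟨hrad, -, -, hdim⟩ := hA
  set F : Fin s → MvPolynomial (Fin n ⊕ Fin t) ℂ := fun i => toC (f i) with hF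
  have hFrad : (Ideal.span (Set.range F)).IsRadical := by
    have h := aux_radical _ hrad
    rw [← Set.range_comp] at h
    exact h
  obtain ⟨k, hk⟩ : ∃ k, n = d + k := ⟨n - d, by omega⟩
  obtain ⟨P, hP, hFP, hmP, hyP⟩ := aux_prime F k {z | z ∈ VC f ∧ (jacXAt F z).rank < k}
    (fun z hz => hz) (fun p hp => by
      obtain ⟨z, hz, hz'⟩ := hcon p hp
      exact ⟨z, ⟨hz.1, by have := hz.2; omega⟩, hz'⟩)
  have hminor := aux_minors F k P hFP hmP hyP
  have hsub : MvPolynomial.zeroLocus ℂ P ⊆ singLocus (VC f) (d + t) := by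
    intro z hz
    refine aux_sing F hFrad (d + t) z ?_ ?_
    · rintro _ ⟨i, rfl⟩
      exact hz _ (hFP i)
    · by_contra hge
      have hge' : k ≤ (Matrix.of fun i j => eval z (pderiv j (F i)) :
          Matrix (Fin s) (Fin n ⊕ Fin t) ℂ).rank := by
        simp only [Fintype.card_sum, Fintype.card_fin] at hge
        omega
      obtain ⟨r, c, hrc⟩ := aux_minor _ k hge'
      apply hrc
      have h := hz _ (hminor r c)
      rw [aeval_eq_eval] at h
      rw [← h, RingHom.map_det]
      rfl
  have hle : vIdeal (singLocus (VC f) (d + t)) ≤ P := by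
    rw [← MvPolynomial.IsPrime.vanishingIdeal_zeroLocus (K := ℂ) P]
    intro p hp z hz
    exact hp z (hsub hz)
  have h1 : ringKrullDim (MvPolynomial (Fin n ⊕ Fin t) ℂ ⧸ P) ≤
      setDim (singLocus (VC f) (d + t)) :=
    ringKrullDim_le_of_surjective (Ideal.Quotient.factor hle) (Ideal.Quotient.factor_surjective hle)
  have h2 := aux_dim t _ hyP
  exact absurd hdim (not_lt.2 (h2.trans h1))

end
end
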